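/- arXiv:1810.12053 — 5 statements merged into one kernel-verified Lean document; each statement's English description precedes it below -/
import Mathlib

section
/- Let d > 1, e > 1 and n ≥ 2. The listed expressions defining Λ₂, …, Λₙ are pairwise distinct elements of G(de,e,n), and the map sending (k, a₂, a₃, …, aₙ), with 0 ≤ k ≤ d−1 and aᵢ ranging over the i·de listed expressions of Λᵢ, to the product z^k · a₂ · a₃ ⋯ aₙ is a bijection onto G(de,e,n). In particular every element of G(de,e,n) has a unique such normal form. -/
noncomputable section

open Complex Matrix

/-- ζ_m = exp(2πi/m). -/
def zetaC (m : ℕ) : ℂ := Complex.exp (2 * Real.pi * Complex.I / m)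

/-- The complex reflection group `G(de,e,n)` realized as a set of monomial matrices:
exactly one nonzero entry in each row and column, the nonzero entries are `de`-th roots
of unity and their product is a `d`-th root of unity. -/
def Gdeen (d e n : ℕ) : Set (Matrix (Fin n) (Fin n) ℂ) :=
  {w | ∃ σ : Equiv.Perm (Fin n),
    (∀ i j, w i j ≠ 0 ↔ j = σ i) ∧
    (∀ i, (w i (σ i)) ^ (d * e) = 1) ∧
    (∏ i, w i (σ i)) ^ d = 1}

/-- The diagonal matrix `z = diag(ζ_d, 1, …, 1)`. -/
def zMat (d n : ℕ) : Matrix (Fin n) (Fin n) ℂ :=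
  Matrix.of fun i j => if i = j then (if (i : ℕ) = 0 then zetaC d else 1) else 0

/-- The generator `t_k` of `G(de,e,n)`: identity outside the top-left 2×2 block,
with top-left block `[[0, ζ_{de}^{-k}], [ζ_{de}^{k}, 0]]`. -/
def tMat (de n k : ℕ) : Matrix (Fin n) (Fin n) ℂ :=
  Matrix.of fun i j =>
    if (i : ℕ) = 0 ∧ (j : ℕ) = 1 then (zetaC de ^ k)⁻¹
    else if (i : ℕ) = 1 ∧ (j : ℕ) = 0 then zetaC de ^ k
    else if i = j ∧ 2 ≤ (i : ℕ) then 1 else 0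

/-- The permutation matrix `s_j` of the transposition `(j-1, j)` (1-indexed). -/
def sMat (n j : ℕ) : Matrix (Fin n) (Fin n) ℂ :=
  Matrix.of fun a b =>
    if ((a : ℕ) = j - 2 ∧ (b : ℕ) = j - 1) ∨ ((a : ℕ) = j - 1 ∧ (b : ℕ) = j - 2) then 1
    else if a = b ∧ (a : ℕ) ≠ j - 2 ∧ (a : ℕ) ≠ j - 1 then 1 else 0

/-- Decreasing-index product `s_i s_{i-1} ⋯ s_{i'}` (empty when `i < i'`). -/
def sDescM (n i i' : ℕ) : Matrix (Fin n) (Fin n) ℂ :=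
  (((List.range' i' (i + 1 - i')).reverse).map (sMat n)).prod

/-- Increasing-index product `s_{i'} s_{i'+1} ⋯ s_i` (empty when `i < i'`). -/
def sAscM (n i' i : ℕ) : Matrix (Fin n) (Fin n) ℂ :=
  ((List.range' i' (i + 1 - i')).map (sMat n)).prod

/-- Index type enumerating the `i·de` listed expressions of `Λ_i`:
`1`; `s_i ⋯ s_{i'}` for `3 ≤ i' ≤ i`; `s_i ⋯ s₃ t_k` for `0 ≤ k ≤ de-1`;
`s_i ⋯ s₃ t_k s₂ s₃ ⋯ s_{i'}` for `1 ≤ k ≤ de-1`, `2 ≤ i' ≤ i`. -/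
inductive LamIdx (de i : ℕ) : Type
  | one : LamIdx de i
  | sdesc (i' : ℕ) (h3 : 3 ≤ i') (hi : i' ≤ i) : LamIdx de i
  | st (k : ℕ) (hk : k < de) : LamIdx de i
  | stst (k : ℕ) (hk1 : 1 ≤ k) (hk : k < de) (i' : ℕ) (h2 : 2 ≤ i') (hi : i' ≤ i) : LamIdx de i

/-- Evaluation of a listed expression of `Λ_i` in `G(de,e,n)` (recall `s₂ = t₀`,
and `s₃ ⋯ s_{i'}` is the empty product when `i' = 2`). -/
def lamEvalM (d e n i : ℕ) : LamIdx (d * e) i → Matrix (Fin n) (Fin n) ℂ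
  | .one => 1
  | .sdesc i' _ _ => sDescM n i i'
  | .st k _ => sDescM n i 3 * tMat (d * e) n k
  | .stst k _ _ i' _ _ => sDescM n i 3 * tMat (d * e) n k * tMat (d * e) n 0 * sAscM n 3 i'

/-- Index of a normal form: an exponent `0 ≤ k ≤ d-1` together with one listed
expression of `Λ_i` for each `2 ≤ i ≤ n`. -/
def NFIdx (d e n : ℕ) : Type := Fin d × (∀ j : Fin (n - 1), LamIdx (d * e) (j.val + 2))

/-- The product `z^k · a₂ · a₃ ⋯ aₙ` associated with a normal form index. -/
def nfEval (d e n : ℕ) (p : NFIdx d e n) : Matrix (Fin n) (Fin n) ℂ :=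
  zMat d n ^ (p.1 : ℕ) *
    ((List.finRange (n - 1)).map (fun j : Fin (n - 1) => lamEvalM d e n (j.val + 2) (p.2 j))).prod

/-- The monomial matrix with coefficients `c` and permutation `σ`. -/
def Mon {n : ℕ} (c : Fin n → ℂ) (σ : Equiv.Perm (Fin n)) : Matrix (Fin n) (Fin n) ℂ :=
  Matrix.of fun i j => if j = σ i then c i else 0

lemma Mon_mul {n : ℕ} (c c' : Fin n → ℂ) (σ τ : Equiv.Perm (Fin n)) :
    Mon c σ * Mon c' τ = Mon (fun i => c i * c' (σ i)) (τ * σ) := by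
  ext i j
  simp only [Mon, Matrix.mul_apply, Matrix.of_apply, Equiv.Perm.mul_apply]
  rw [Finset.sum_eq_single (σ i)]
  · by_cases h : j = τ (σ i) <;> simp [h]
  · intro b _ hb
    simp [hb]
  · simp

lemma Mon_one {n : ℕ} : Mon (fun _ : Fin n => (1 : ℂ)) 1 = 1 := by
  ext i j
  simp [Mon, Matrix.one_apply, eq_comm]

lemma mem_G_iff {d e n : ℕ} (hde : d * e ≠ 0) (w : Matrix (Fin n) (Fin n) ℂ) :
    w ∈ Gdeen d e n ↔ ∃ (c : Fin n → ℂ) (σ : Equiv.Perm (Fin n)),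
      w = Mon c σ ∧ (∀ i, c i ^ (d * e) = 1) ∧ (∏ i, c i) ^ d = 1 := by
  constructor
  · rintro ⟨σ, h1, h2, h3⟩
    refine ⟨fun i => w i (σ i), σ, ?_, h2, h3⟩
    ext i j
    by_cases h : j = σ i
    · subst h
      simp [Mon]
    · have := (h1 i j).not.mpr h
      simp only [ne_eq, not_not] at this
      simp [Mon, h, this]
  · rintro ⟨c, σ, rfl, h2, h3⟩
    refine ⟨σ, ?_, ?_, ?_⟩
    · intro i j
      have : c i ≠ 0 := by
        intro h
        have := h2 i
        rw [h, zero_pow hde] at this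
        exact zero_ne_one this
      simp [Mon, this]
    · simpa [Mon] using h2
    · simpa [Mon] using h3

lemma G_mul {d e n : ℕ} (hde : d * e ≠ 0) {w w' : Matrix (Fin n) (Fin n) ℂ}
    (h : w ∈ Gdeen d e n) (h' : w' ∈ Gdeen d e n) : w * w' ∈ Gdeen d e n := by
  rw [mem_G_iff hde] at *
  obtain ⟨c, σ, rfl, h1, h2⟩ := h
  obtain ⟨c', σ', rfl, h1', h2'⟩ := h'
  refine ⟨_, _, Mon_mul _ _ _ _, ?_, ?_⟩
  · intro i
    rw [mul_pow, h1, h1', one_mul]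
  · rw [Finset.prod_mul_distrib, Equiv.prod_comp σ c', mul_pow, h2, h2', one_mul]

lemma G_one {d e n : ℕ} (hde : d * e ≠ 0) : (1 : Matrix (Fin n) (Fin n) ℂ) ∈ Gdeen d e n := by
  rw [mem_G_iff hde]
  exact ⟨_, _, Mon_one.symm, by simp, by simp⟩

lemma G_inv {d e n : ℕ} (hde : d * e ≠ 0) {w : Matrix (Fin n) (Fin n) ℂ}
    (h : w ∈ Gdeen d e n) : ∃ w' ∈ Gdeen d e n, w * w' = 1 ∧ w' * w = 1 := by
  rw [mem_G_iff hde] at h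
  obtain ⟨c, σ, rfl, h1, h2⟩ := h
  have hc : ∀ i, c i ≠ 0 := by
    intro i h
    have := h1 i
    rw [h, zero_pow hde] at this
    exact zero_ne_one this
  refine ⟨Mon (fun i => (c (σ⁻¹ i))⁻¹) σ⁻¹, ?_, ?_, ?_⟩
  · rw [mem_G_iff hde]
    refine ⟨_, _, rfl, ?_, ?_⟩
    · intro i
      rw [inv_pow, h1, inv_one]
    · rw [Equiv.prod_comp σ⁻¹ (fun i => (c i)⁻¹), Finset.prod_inv_distrib, inv_pow, h2, inv_one]
  · rw [Mon_mul, ← Mon_one]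
    simp [hc]
  · rw [Mon_mul, ← Mon_one]
    simp [hc]

/-- Row `r` of `A` is `c` times the basis vector `e_s`. -/
def IsRow {n : ℕ} (A : Matrix (Fin n) (Fin n) ℂ) (r : ℕ) (c : ℂ) (s : ℕ) : Prop :=
  ∀ i j : Fin n, i.val = r → A i j = if j.val = s then c else 0

lemma IsRow.mul {n : ℕ} {A B : Matrix (Fin n) (Fin n) ℂ} {r s u : ℕ} {c c' : ℂ}
    (hs : s < n) (hA : IsRow A r c s) (hB : IsRow B s c' u) : IsRow (A * B) r (c * c') u := by
  intro i j hi
  rw [Matrix.mul_apply, Finset.sum_eq_single (⟨s, hs⟩ : Fin n)]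
  · rw [hA i _ hi, hB _ j rfl]
    simp
  · intro b _ hb
    rw [hA i _ hi, if_neg, zero_mul]
    exact fun h => hb (Fin.ext h)
  · simp

lemma IsRow.one {n : ℕ} (r : ℕ) : IsRow (1 : Matrix (Fin n) (Fin n) ℂ) r 1 r := by
  intro i j hi
  subst hi
  simp [Matrix.one_apply, Fin.ext_iff, eq_comm]

/-- Elements of `G(de,e,n)` which are the identity on rows of index `≥ m`. -/
def HG (d e n m : ℕ) : Set (Matrix (Fin n) (Fin n) ℂ) :=
  {w | w ∈ Gdeen d e n ∧ ∀ r, m ≤ r → r < n → IsRow w r 1 r}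

lemma HG_mono {d e n m m' : ℕ} (h : m ≤ m') {w : Matrix (Fin n) (Fin n) ℂ}
    (hw : w ∈ HG d e n m) : w ∈ HG d e n m' :=
  ⟨hw.1, fun r hr => hw.2 r (h.trans hr)⟩

lemma HG_mul {d e n m : ℕ} (hde : d * e ≠ 0) {w w' : Matrix (Fin n) (Fin n) ℂ}
    (h : w ∈ HG d e n m) (h' : w' ∈ HG d e n m) : w * w' ∈ HG d e n m :=
  ⟨G_mul hde h.1 h'.1, fun r hr hn => by
    simpa using (h.2 r hr hn).mul hn (h'.2 r hr hn)⟩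

lemma HG_one {d e n m : ℕ} (hde : d * e ≠ 0) :
    (1 : Matrix (Fin n) (Fin n) ℂ) ∈ HG d e n m :=
  ⟨G_one hde, fun r _ _ => IsRow.one r⟩

lemma mul_apply_of_row_eq {n : ℕ} {A B C : Matrix (Fin n) (Fin n) ℂ} {i : Fin n}
    (h : ∀ j, A i j = B i j) (j : Fin n) : (A * C) i j = (B * C) i j := by
  simp [Matrix.mul_apply, h]

lemma HG_inv {d e n m : ℕ} (hde : d * e ≠ 0) {w : Matrix (Fin n) (Fin n) ℂ}
    (h : w ∈ HG d e n m) : ∃ w' ∈ HG d e n m, w * w' = 1 ∧ w' * w = 1 := by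
  obtain ⟨w', h1, h2, h3⟩ := G_inv hde h.1
  refine ⟨w', ⟨h1, ?_⟩, h2, h3⟩
  intro r hr hn i j hi
  have := mul_apply_of_row_eq (A := w) (B := 1) (C := w') (i := i)
    (fun k => by rw [h.2 r hr hn i k hi, IsRow.one r i k hi]) j
  rw [h2, one_mul] at this
  rw [← this, IsRow.one r i j hi]

lemma HG_list {d e n m : ℕ} (hde : d * e ≠ 0) (l : List (Matrix (Fin n) (Fin n) ℂ))
    (h : ∀ w ∈ l, w ∈ HG d e n m) : l.prod ∈ HG d e n m := by
  induction l with
  | nil => simpa using HG_one hde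
  | cons a l ih =>
    rw [List.prod_cons]
    exact HG_mul hde (h a (by simp)) (ih fun w hw => h w (by simp [hw]))

lemma zetaC_prim {m : ℕ} (hm : m ≠ 0) : IsPrimitiveRoot (zetaC m) m := by
  exact Complex.isPrimitiveRoot_exp m hm

/-! ### Generators -/

lemma sMat_row (n j r : ℕ) : IsRow (sMat n j) r 1
    (if r = j - 2 then j - 1 else if r = j - 1 then j - 2 else r) := by
  intro a b ha
  subst ha
  simp only [sMat, Matrix.of_apply, Fin.ext_iff]
  grind

lemma sMat_HG {d e n j m : ℕ} (hde : d * e ≠ 0) (h2 : 2 ≤ j) (hj : j ≤ n) (hm : j ≤ m) :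
    sMat n j ∈ HG d e n m := by
  constructor
  · rw [mem_G_iff hde]
    refine ⟨fun _ => 1, Equiv.swap ⟨j - 2, by omega⟩ ⟨j - 1, by omega⟩, ?_, by simp, by simp⟩
    ext a b
    simp only [sMat, Mon, Matrix.of_apply, Equiv.swap_apply_def, Fin.ext_iff]
    grind
  · intro r hr _
    have := sMat_row n j r
    rwa [if_neg (by omega), if_neg (by omega)] at this

lemma tMat_row0 (N n k : ℕ) : IsRow (tMat N n k) 0 ((zetaC N ^ k)⁻¹) 1 := by
  intro a b ha
  simp [tMat, ha]

lemma tMat_row1 (N n k : ℕ) : IsRow (tMat N n k) 1 (zetaC N ^ k) 0 := by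
  intro a b ha
  simp [tMat, ha]

lemma tMat_row2 (N n k r : ℕ) (hr : 2 ≤ r) : IsRow (tMat N n k) r 1 r := by
  intro a b ha
  simp only [tMat, Matrix.of_apply, Fin.ext_iff]
  grind

lemma tMat_HG {d e n k m : ℕ} (hde : d * e ≠ 0) (hn : 2 ≤ n) (hm : 2 ≤ m) :
    tMat (d * e) n k ∈ HG d e n m := by
  have hz := zetaC_prim hde
  have hz0 : zetaC (d * e) ^ k ≠ 0 := pow_ne_zero _ (hz.ne_zero hde)
  have hz1 : (zetaC (d * e) ^ k) ^ (d * e) = 1 := by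
    rw [pow_right_comm, hz.pow_eq_one, one_pow]
  constructor
  · rw [mem_G_iff hde]
    refine ⟨fun i => if i.val = 0 then (zetaC (d * e) ^ k)⁻¹ else if i.val = 1 then zetaC (d * e) ^ k else 1,
      Equiv.swap ⟨0, by omega⟩ ⟨1, by omega⟩, ?_, ?_, ?_⟩
    · ext a b
      simp only [tMat, Mon, Matrix.of_apply, Equiv.swap_apply_def, Fin.ext_iff]
      grind
    · intro i
      dsimp only
      split_ifs
      · rw [inv_pow, hz1, inv_one]
      · exact hz1
      · simp
    · obtain ⟨n, rfl⟩ : ∃ l, n = l + 2 := ⟨n - 2, by omega⟩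
      rw [Fin.prod_univ_succ, Fin.prod_univ_succ]
      simp [hz0]
  · intro r hr _
    exact tMat_row2 _ _ _ _ (by omega)

lemma zMat_pow (d n k : ℕ) : zMat d n ^ k =
    Matrix.diagonal fun i : Fin n => if i.val = 0 then zetaC d ^ k else 1 := by
  have : zMat d n = Matrix.diagonal fun i : Fin n => if i.val = 0 then zetaC d else 1 := by
    ext i j
    simp [zMat, Matrix.diagonal_apply]
  rw [this, Matrix.diagonal_pow]
  congr 1
  ext i
  simp only [Pi.pow_apply]
  split_ifs <;> simp

lemma zMat_HG {d e n k : ℕ} (hde : d * e ≠ 0) (hn : 2 ≤ n) : zMat d n ^ k ∈ HG d e n 1 := by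
  have hd : d ≠ 0 := by rintro rfl; simp at hde
  have hz := zetaC_prim hd
  have hz1 : (zetaC d ^ k) ^ d = 1 := by rw [← pow_mul, mul_comm, pow_mul, hz.pow_eq_one, one_pow]
  rw [zMat_pow]
  constructor
  · rw [mem_G_iff hde]
    refine ⟨fun i => if i.val = 0 then zetaC d ^ k else 1, 1, ?_, ?_, ?_⟩
    · ext i j
      simp [Mon, Matrix.diagonal_apply, eq_comm]
    · intro i
      dsimp only
      split_ifs
      · rw [pow_mul, hz1, one_pow]
      · simp
    · obtain ⟨n, rfl⟩ : ∃ l, n = l + 1 := ⟨n - 1, by omega⟩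
      rw [Fin.prod_univ_succ]
      simp [hz1]
  · intro r hr _ i j hi
    have : i.val ≠ 0 := by omega
    simp only [Matrix.diagonal_apply, Fin.ext_iff, this, if_false]
    grind

/-! ### Rows of the listed expressions -/

lemma sDescM_self (n i i' : ℕ) (h : i < i') : sDescM n i i' = 1 := by
  simp [sDescM, show i + 1 - i' = 0 by omega]

lemma sDescM_succ (n i i' : ℕ) (h : i' ≤ i + 1) :
    sDescM n (i + 1) i' = sMat n (i + 1) * sDescM n i i' := by
  unfold sDescM
  rw [show i + 1 + 1 - i' = (i + 1 - i') + 1 by omega, List.range'_1_concat]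
  simp [show i' + (i + 1 - i') = i + 1 by omega]

lemma sAscM_self (n i i' : ℕ) (h : i < i') : sAscM n i' i = 1 := by
  simp [sAscM, show i + 1 - i' = 0 by omega]

lemma sAscM_succ (n i i' : ℕ) (h : i' ≤ i + 1) :
    sAscM n i' (i + 1) = sAscM n i' i * sMat n (i + 1) := by
  unfold sAscM
  rw [show i + 1 + 1 - i' = (i + 1 - i') + 1 by omega, List.range'_1_concat]
  simp [show i' + (i + 1 - i') = i + 1 by omega]

lemma sDescM_row (n i' i : ℕ) (h2 : 3 ≤ i') (h : i' ≤ i + 1) (hn : i ≤ n) :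
    IsRow (sDescM n i i') (i - 1) 1 (i' - 2) := by
  induction i with
  | zero => omega
  | succ i ih =>
    rcases Nat.lt_or_ge (i + 1) i' with h' | h'
    · rw [sDescM_self _ _ _ h', show i + 1 - 1 = i' - 2 by omega]
      exact IsRow.one _
    · rw [sDescM_succ _ _ _ h']
      have h1 := sMat_row n (i + 1) (i + 1 - 1)
      rw [if_neg (by omega), if_pos rfl] at h1
      have := h1.mul (by omega) (ih h' (by omega))
      simpa using this

lemma sAscM_row (n i : ℕ) (h2 : 2 ≤ i) (hn : i ≤ n) :
    IsRow (sAscM n 3 i) 1 1 (i - 1) := by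
  induction i, h2 using Nat.le_induction with
  | base =>
    rw [sAscM_self _ _ _ (by omega)]
    exact IsRow.one _
  | succ i hi ih =>
    rw [sAscM_succ _ _ _ (by omega)]
    have h1 := sMat_row n (i + 1) (i - 1)
    rw [if_pos (by omega)] at h1
    have := (ih (by omega)).mul (by omega) h1
    simpa using this

lemma sDescM_HG {d e n m i i' : ℕ} (hde : d * e ≠ 0) (h2 : 2 ≤ i') (hn : i ≤ n) (hm : i ≤ m) :
    sDescM n i i' ∈ HG d e n m := by
  apply HG_list hde
  intro w hw
  simp only [List.mem_map, List.mem_reverse, List.mem_range'_1] at hw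
  obtain ⟨j, hj, rfl⟩ := hw
  exact sMat_HG hde (by omega) (by omega) (by omega)

lemma sAscM_HG {d e n m i i' : ℕ} (hde : d * e ≠ 0) (h2 : 2 ≤ i') (hn : i ≤ n) (hm : i ≤ m) :
    sAscM n i' i ∈ HG d e n m := by
  apply HG_list hde
  intro w hw
  simp only [List.mem_map, List.mem_range'_1] at hw
  obtain ⟨j, hj, rfl⟩ := hw
  exact sMat_HG hde (by omega) (by omega) (by omega)

/-- Exponent and position of the nonzero entry of the row `i - 1`. -/
def lamKey {N i : ℕ} : LamIdx N i → ℕ × ℕ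
  | .one => (0, i - 1)
  | .sdesc i' _ _ => (0, i' - 2)
  | .st k _ => (k, 0)
  | .stst k _ _ i' _ _ => (k, i' - 1)

lemma lamKey_lt {N i : ℕ} (hN : 0 < N) (hi : 2 ≤ i) (a : LamIdx N i) :
    (lamKey a).1 < N ∧ (lamKey a).2 < i := by
  cases a <;> simp only [lamKey] <;> omega

lemma lamKey_inj {N i : ℕ} (hi : 2 ≤ i) : Function.Injective (lamKey (N := N) (i := i)) := by
  intro a b h
  cases a <;> cases b <;> simp only [lamKey, Prod.mk.injEq] at h <;>
    first
    | rfl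
    | (exfalso; omega)
    | (congr 1 <;> omega)

lemma lamKey_surj {N i : ℕ} (k s : ℕ) (hk : k < N) (hs : s < i) :
    ∃ a : LamIdx N i, lamKey a = (k, s) := by
  rcases Nat.eq_zero_or_pos s with rfl | hs0
  · exact ⟨.st k hk, rfl⟩
  rcases Nat.eq_zero_or_pos k with rfl | hk0
  · by_cases h : s = i - 1
    · exact ⟨.one, by simp [lamKey, h]⟩
    · exact ⟨.sdesc (s + 2) (by omega) (by omega), by simp [lamKey]⟩
  · exact ⟨.stst k hk0 hk (s + 1) (by omega) (by omega), by simp [lamKey]⟩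

lemma lam_row {d e n i : ℕ} (h2 : 2 ≤ i) (hn : i ≤ n) (a : LamIdx (d * e) i) :
    IsRow (lamEvalM d e n i a) (i - 1) (zetaC (d * e) ^ (lamKey a).1) (lamKey a).2 := by
  cases a with
  | one => simpa [lamKey, lamEvalM] using IsRow.one (n := n) (i - 1)
  | sdesc i' h3 hi => simpa [lamKey, lamEvalM] using sDescM_row n i' i h3 (by omega) hn
  | st k hk =>
    simpa [lamKey, lamEvalM] using
      (sDescM_row n 3 i le_rfl (by omega) hn).mul (by omega) (tMat_row1 (d * e) n k)
  | stst k hk1 hk i' h2' hi =>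
    have h1 := (sDescM_row n 3 i le_rfl (by omega) hn).mul (by omega) (tMat_row1 (d * e) n k)
    have h2 := (h1.mul (by omega) (tMat_row0 (d * e) n 0)).mul (by omega)
      (sAscM_row n i' h2' (by omega))
    simpa [lamKey, lamEvalM] using h2

lemma lam_HG {d e n i : ℕ} (hde : d * e ≠ 0) (h2 : 2 ≤ i) (hn : i ≤ n) (a : LamIdx (d * e) i) :
    lamEvalM d e n i a ∈ HG d e n i := by
  cases a with
  | one => exact HG_one hde
  | sdesc i' h3 hi => exact sDescM_HG hde (by omega) hn le_rfl
  | st k hk =>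
    exact HG_mul hde (sDescM_HG hde (by omega) hn le_rfl) (tMat_HG hde (by omega) h2)
  | stst k hk1 hk i' h2' hi =>
    exact HG_mul hde (HG_mul hde (HG_mul hde (sDescM_HG hde (by omega) hn le_rfl)
      (tMat_HG hde (by omega) h2)) (tMat_HG hde (by omega) h2))
      (sAscM_HG hde (by omega) (by omega) hi)

/-- A listed expression is determined by its row `i - 1`. -/
lemma lam_inj_row {d e n i : ℕ} (hde : d * e ≠ 0) (h2 : 2 ≤ i) (hn : i ≤ n)
    (a b : LamIdx (d * e) i)
    (h : ∀ j, lamEvalM d e n i a ⟨i - 1, by omega⟩ j = lamEvalM d e n i b ⟨i - 1, by omega⟩ j) :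
    a = b := by
  have hz := zetaC_prim hde
  have ha := lamKey_lt (Nat.pos_of_ne_zero hde) h2 a
  have hb := lamKey_lt (Nat.pos_of_ne_zero hde) h2 b
  apply lamKey_inj h2
  have h1 := h ⟨(lamKey a).2, by omega⟩
  rw [lam_row h2 hn a _ _ rfl, lam_row h2 hn b _ _ rfl, if_pos rfl] at h1
  dsimp only at h1
  split_ifs at h1 with h3
  · exact Prod.ext (hz.pow_inj ha.1 hb.1 h1) h3
  · exact absurd h1 (pow_ne_zero _ (hz.ne_zero hde))

/-! ### Partial products -/

/-- Partial normal form product. -/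
def partNF (d e n k : ℕ) (f : ∀ j : ℕ, LamIdx (d * e) (j + 2)) (m : ℕ) :
    Matrix (Fin n) (Fin n) ℂ :=
  zMat d n ^ k * ((List.range m).map (fun j => lamEvalM d e n (j + 2) (f j))).prod

lemma partNF_succ (d e n k : ℕ) (f : ∀ j : ℕ, LamIdx (d * e) (j + 2)) (m : ℕ) :
    partNF d e n k f (m + 1) = partNF d e n k f m * lamEvalM d e n (m + 2) (f m) := by
  simp [partNF, List.range_succ, mul_assoc]

lemma partNF_congr (d e n k : ℕ) (f g : ∀ j : ℕ, LamIdx (d * e) (j + 2)) (m : ℕ)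
    (h : ∀ j < m, f j = g j) : partNF d e n k f m = partNF d e n k g m := by
  unfold partNF
  congr 2
  apply List.map_congr_left
  intro j hj
  rw [h j (List.mem_range.mp hj)]

lemma partNF_HG {d e n : ℕ} (hde : d * e ≠ 0) (hn : 2 ≤ n) (k : ℕ)
    (f : ∀ j : ℕ, LamIdx (d * e) (j + 2)) (m : ℕ) (hm : m + 1 ≤ n) :
    partNF d e n k f m ∈ HG d e n (m + 1) := by
  induction m with
  | zero => simpa [partNF] using zMat_HG hde hn
  | succ m ih =>
    rw [partNF_succ]
    exact HG_mul hde (HG_mono (by omega) (ih (by omega))) (lam_HG hde (by omega) (by omega) _)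

lemma partNF_inj {d e n : ℕ} (hde : d * e ≠ 0) (hn : 2 ≤ n) (k k' : ℕ) (hk : k < d) (hk' : k' < d)
    (f f' : ∀ j : ℕ, LamIdx (d * e) (j + 2)) (m : ℕ) (hm : m + 1 ≤ n)
    (h : partNF d e n k f m = partNF d e n k' f' m) : k = k' ∧ ∀ j < m, f j = f' j := by
  induction m with
  | zero =>
    have h0 := congrFun (congrFun h ⟨0, by omega⟩) ⟨0, by omega⟩
    simp only [partNF, zMat_pow, List.range_zero, List.map_nil, List.prod_nil, mul_one,
      Matrix.diagonal_apply_eq, if_true] at h0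
    exact ⟨(zetaC_prim (by omega)).pow_inj hk hk' h0, by simp⟩
  | succ m ih =>
    rw [partNF_succ, partNF_succ] at h
    have key : ∀ (k : ℕ) (f : ∀ j : ℕ, LamIdx (d * e) (j + 2)) (j : Fin n),
        (partNF d e n k f m * lamEvalM d e n (m + 2) (f m)) ⟨m + 2 - 1, by omega⟩ j =
        lamEvalM d e n (m + 2) (f m) ⟨m + 2 - 1, by omega⟩ j := by
      intro k f j
      have := mul_apply_of_row_eq (A := partNF d e n k f m) (B := 1)
        (C := lamEvalM d e n (m + 2) (f m)) (i := ⟨m + 2 - 1, by omega⟩)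
        (fun j => by
          rw [(partNF_HG hde hn k f m (by omega)).2 (m + 1) le_rfl (by omega) _ j rfl,
            IsRow.one (m + 1) _ j rfl]) j
      rwa [one_mul] at this
    have hf : f m = f' m := by
      apply lam_inj_row hde (by omega) (show m + 2 ≤ n by omega)
      intro j
      rw [← key k f j, ← key k' f' j, h]
    rw [hf] at h
    obtain ⟨b, -, hb, -⟩ := HG_inv hde (lam_HG hde (by omega) (show m + 2 ≤ n by omega) (f' m))
    have h2 := congrArg (· * b) h
    simp only [mul_assoc, hb, mul_one] at h2
    obtain ⟨h3, h4⟩ := ih (by omega) h2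
    refine ⟨h3, fun j hj => ?_⟩
    rcases Nat.lt_succ_iff_lt_or_eq.mp hj with h5 | rfl
    · exact h4 j h5
    · exact hf

/-- The row `m` of an element of `HG (m+1)` . -/
lemma HG_row {d e n m : ℕ} (hde : d * e ≠ 0) (hm : m < n) {w : Matrix (Fin n) (Fin n) ℂ}
    (h : w ∈ HG d e n (m + 1)) :
    ∃ k < d * e, ∃ s < m + 1, IsRow w m (zetaC (d * e) ^ k) s := by
  obtain ⟨hG, hr⟩ := h
  rw [mem_G_iff hde] at hG
  obtain ⟨c, σ, rfl, h1, h2⟩ := hG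
  have : NeZero (d * e) := ⟨hde⟩
  obtain ⟨k, hk, hk2⟩ := (zetaC_prim hde).eq_pow_of_pow_eq_one (h1 ⟨m, hm⟩)
  refine ⟨k, hk, (σ ⟨m, hm⟩).val, ?_, ?_⟩
  · by_contra hlt
    have h3 := hr (σ ⟨m, hm⟩).val (by omega) (σ ⟨m, hm⟩).2 (σ ⟨m, hm⟩) (σ ⟨m, hm⟩) rfl
    simp only [Mon, Matrix.of_apply, if_true] at h3
    split_ifs at h3 with h4
    · have := congrArg Fin.val (σ.injective h4)
      simp only at this
      omega
    · exact zero_ne_one h3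
  · intro i j hi
    have : i = ⟨m, hm⟩ := Fin.ext hi
    subst this
    simp [Mon, hk2, Fin.ext_iff]

lemma partNF_surj {d e n : ℕ} (hde : d * e ≠ 0) (hn : 2 ≤ n) (m : ℕ) (hm : m + 1 ≤ n)
    (w : Matrix (Fin n) (Fin n) ℂ) (hw : w ∈ HG d e n (m + 1)) :
    ∃ k < d, ∃ f : ∀ j : ℕ, LamIdx (d * e) (j + 2), partNF d e n k f m = w := by
  have hd : d ≠ 0 := by rintro rfl; simp at hde
  induction m generalizing w with
  | zero =>
    obtain ⟨k₀, _, s, hs, hrow⟩ := HG_row hde hm hw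
    obtain ⟨hG, hr⟩ := hw
    rw [mem_G_iff hde] at hG
    obtain ⟨c, σ, rfl, h1, h2⟩ := hG
    have hσ : σ = 1 := by
      ext i
      by_cases hi : i.val = 0
      · have h3 := hrow i (σ i) hi
        have hc : c i ≠ 0 := by
          intro h
          have := h1 i
          rw [h, zero_pow hde] at this
          exact zero_ne_one this
        simp only [Mon, Matrix.of_apply, if_true] at h3
        split_ifs at h3 with h4
        · simp only [Equiv.Perm.one_apply]
          omega
        · exact absurd h3 hc
      · have h3 := hr i.val (by omega) i.2 i i rfl
        simp only [Mon, Matrix.of_apply, if_true] at h3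
        split_ifs at h3 with h4
        · simp [← h4]
        · exact absurd h3 zero_ne_one
    subst hσ
    have hc : ∀ i : Fin n, i.val ≠ 0 → c i = 1 := by
      intro i hi
      have h3 := hr i.val (by omega) i.2 i i rfl
      simpa [Mon] using h3
    have hp : ∏ i, c i = c ⟨0, by omega⟩ := by
      apply Finset.prod_eq_single
      · intro b _ hb
        exact hc b fun h => hb (Fin.ext h)
      · simp
    rw [hp] at h2
    have : NeZero d := ⟨hd⟩
    obtain ⟨k, hk, hk2⟩ := (zetaC_prim hd).eq_pow_of_pow_eq_one h2
    refine ⟨k, hk, fun _ => .one, ?_⟩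
    simp only [partNF, zMat_pow, List.range_zero, List.map_nil, List.prod_nil, mul_one]
    ext i j
    simp only [Mon, Matrix.diagonal_apply, Matrix.of_apply, Equiv.Perm.one_apply, eq_comm (a := j)]
    congr 1
    split_ifs with hi
    · rw [hk2]
      congr 1
      exact Fin.ext hi.symm
    · exact (hc i hi).symm
  | succ m ih =>
    obtain ⟨k, hk, s, hs, hrow⟩ := HG_row hde (by omega) hw
    obtain ⟨a, ha⟩ := lamKey_surj (i := m + 2) k s hk hs
    have hrow' := lam_row (n := n) (by omega) (by omega) a
    rw [ha] at hrow'
    obtain ⟨b, hbH, hb1, hb2⟩ := HG_inv hde (lam_HG hde (by omega) (show m + 2 ≤ n by omega) a)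
    have hwb : w * b ∈ HG d e n (m + 1) := by
      have h1 := HG_mul hde hw hbH
      refine ⟨h1.1, fun r hr hrn => ?_⟩
      rcases Nat.eq_or_lt_of_le hr with rfl | hr'
      · intro i j hi
        have := mul_apply_of_row_eq (A := w) (B := lamEvalM d e n (m + 2) a) (C := b) (i := i)
          (fun j => by rw [hrow i j hi, hrow' i j hi]) j
        rw [this, hb1, IsRow.one _ i j hi]
      · exact h1.2 r hr' hrn
    obtain ⟨l, hl, f, hf⟩ := ih (by omega) _ hwb
    refine ⟨l, hl, Function.update f m a, ?_⟩
    rw [partNF_succ, partNF_congr d e n l _ f m, hf, Function.update_self, mul_assoc, hb2, mul_one]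
    intro j hj
    rw [Function.update_of_ne (by omega)]

lemma nfEval_eq (d e n : ℕ) (p : NFIdx d e n) (f : ∀ j : ℕ, LamIdx (d * e) (j + 2))
    (h : ∀ j : Fin (n - 1), f j.val = p.2 j) : nfEval d e n p = partNF d e n p.1 f (n - 1) := by
  unfold nfEval partNF
  rw [← List.map_coe_finRange_eq_range, List.map_map]
  congr 3
  ext1 j
  simp [h]

/-- The listed expressions of each `Λ_i` are pairwise distinct elements of `G(de,e,n)`,
and `(k, a₂, …, aₙ) ↦ z^k a₂ ⋯ aₙ` is a bijection onto `G(de,e,n)`. -/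
theorem normal_forms_for_Gdeen (d e n : ℕ) (hd : 1 < d) (he : 1 < e) (hn : 2 ≤ n) :
    (∀ i : ℕ, 2 ≤ i → i ≤ n → Function.Injective (lamEvalM d e n i)) ∧
    Function.Injective (nfEval d e n) ∧
    Set.range (nfEval d e n) = Gdeen d e n := by
  have hde : d * e ≠ 0 := by positivity
  have hext : ∀ p : NFIdx d e n, ∃ f : ∀ j : ℕ, LamIdx (d * e) (j + 2),
      ∀ j : Fin (n - 1), f j.val = p.2 j := fun p =>
    ⟨fun j => if h : j < n - 1 then p.2 ⟨j, h⟩ else .one, fun j => by simp⟩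
  refine ⟨?_, ?_, ?_⟩
  · intro i h2 hi a b h
    exact lam_inj_row hde h2 hi a b fun j => by rw [h]
  · intro p q h
    obtain ⟨f, hf⟩ := hext p
    obtain ⟨g, hg⟩ := hext q
    rw [nfEval_eq d e n p f hf, nfEval_eq d e n q g hg] at h
    obtain ⟨h1, h2⟩ := partNF_inj hde hn _ _ p.1.2 q.1.2 f g (n - 1) (by omega) h
    refine Prod.ext (Fin.ext h1) (funext fun j => ?_)
    rw [← hf, ← hg, h2 j.val j.2]
  · ext w
    constructor
    · rintro ⟨p, rfl⟩
      obtain ⟨f, hf⟩ := hext p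
      rw [nfEval_eq d e n p f hf]
      exact (partNF_HG hde hn _ f (n - 1) (by omega)).1
    · intro hw
      obtain ⟨k, hk, f, hf⟩ := partNF_surj hde hn (n - 1) (by omega) w
        ⟨hw, fun r h1 h2 => by omega⟩
      exact ⟨(⟨k, hk⟩, fun j => f j.val), 
        (nfEval_eq d e n (⟨k, hk⟩, fun j => f j.val) f (fun _ => rfl)).trans hf⟩
end
end

section
/- Let d > 1, e > 1 and n ≥ 2. The maximal value of ℓ(w) over w ∈ G(de,e,n) is n(n−1) + d − 1. Moreover, the elements attaining this maximal length are exactly the diagonal matrices w ∈ G(de,e,n) such that w[i,i] is a nontrivial de-th root of unity for every 2 ≤ i ≤ n and the product of all diagonal entries of w equals ζ_d^{d−1}; consequently there are exactly (de−1)^{n−1} elements of maximal length. -/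
noncomputable section

open Complex Matrix

/-- The generating set `X = {z, t₀, …, t_{de-1}, s₃, …, sₙ}`. -/
def genX (d e n : ℕ) : Set (Matrix (Fin n) (Fin n) ℂ) :=
  {zMat d n} ∪ {x | ∃ k < d * e, x = tMat (d * e) n k} ∪
    {x | ∃ j, 3 ≤ j ∧ j ≤ n ∧ x = sMat n j}

/-- Minimal length of a word over `X` (no inverses) whose product is `w`. -/
def len {M : Type*} [Monoid M] (X : Set M) (w : M) : ℕ :=
  sInf {k | ∃ l : List M, (∀ x ∈ l, x ∈ X) ∧ l.length = k ∧ l.prod = w}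

namespace GD

lemma zeta_prim (m : ℕ) (hm : m ≠ 0) : IsPrimitiveRoot (zetaC m) m :=
  Complex.isPrimitiveRoot_exp m hm

/-- The monomial matrix with pattern `σ` and phases `a`. -/
def M {n : ℕ} (σ : Equiv.Perm (Fin n)) (a : Fin n → ℂ) : Matrix (Fin n) (Fin n) ℂ :=
  Matrix.of fun i j => if j = σ i then a i else 0

lemma M_mul {n : ℕ} (σ τ : Equiv.Perm (Fin n)) (a b : Fin n → ℂ) :
    M σ a * M τ b = M (τ * σ) (fun i => a i * b (σ i)) := by
  ext i j
  simp only [M, Matrix.mul_apply, Equiv.Perm.mul_apply, Matrix.of_apply]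
  rw [Finset.sum_eq_single (σ i)]
  · by_cases h : j = τ (σ i) <;> simp [h]
  · intro k _ hk; simp [hk]
  · simp

lemma M_one {n : ℕ} : M (1 : Equiv.Perm (Fin n)) (fun _ => 1) = 1 := by
  ext i j
  simp [M, Matrix.one_apply, eq_comm]

/-- The contribution of a pair of rows. -/
def fpair {n : ℕ} (σ : Equiv.Perm (Fin n)) (a : Fin n → ℂ) (j i : Fin n) : ℕ :=
  open Classical in if σ i < σ j then 1 else if a i = 1 then 0 else 2

/-- Pairs of rows. -/
def prs (n : ℕ) : Finset (Fin n × Fin n) := Finset.univ.filter (fun p => p.1 < p.2)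

/-- The combinatorial length. -/
def LL {n : ℕ} (σ : Equiv.Perm (Fin n)) (a : Fin n → ℂ) : ℕ :=
  ∑ p ∈ prs n, fpair σ a p.1 p.2

lemma card_prs (n : ℕ) : 2 * (prs n).card = n * (n - 1) := by
  have : (prs n).card = ∑ i : Fin n, (i : ℕ) := by
    rw [prs, Finset.card_filter, Fintype.sum_prod_type_right]
    refine Finset.sum_congr rfl fun i _ => ?_
    rw [← Finset.card_filter]
    have : Finset.univ.filter (fun x => x < i) = Finset.Iio i := by ext; simp
    rw [this, Fin.card_Iio]
  rw [this, Fin.sum_univ_eq_sum_range (fun i => i) n, mul_comm, Finset.sum_range_id_mul_two]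

lemma fpair_le {n : ℕ} (σ : Equiv.Perm (Fin n)) (a : Fin n → ℂ) (j i : Fin n) :
    fpair σ a j i ≤ 2 := by
  unfold fpair; split_ifs <;> omega

lemma LL_le {n : ℕ} (σ : Equiv.Perm (Fin n)) (a : Fin n → ℂ) : LL σ a ≤ n * (n - 1) := by
  rw [← card_prs, LL, mul_comm]
  exact Finset.sum_le_card_nsmul _ _ _ fun p _ => fpair_le σ a _ _

lemma LL_eq_max_iff {n : ℕ} (σ : Equiv.Perm (Fin n)) (a : Fin n → ℂ) :
    LL σ a = n * (n - 1) ↔ ∀ j i : Fin n, j < i → fpair σ a j i = 2 := by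
  have h : n * (n - 1) = ∑ p ∈ prs n, 2 := by simp [← card_prs, mul_comm]
  rw [h, LL, Finset.sum_eq_sum_iff_of_le fun p _ => fpair_le σ a _ _]
  simp [prs]

lemma LL_eq_zero_iff {n : ℕ} (σ : Equiv.Perm (Fin n)) (a : Fin n → ℂ) :
    LL σ a = 0 ↔ ∀ j i : Fin n, j < i → fpair σ a j i = 0 := by
  rw [LL, Finset.sum_eq_zero_iff]
  simp [prs]

lemma perm_eq_one {n : ℕ} (σ : Equiv.Perm (Fin n)) (h : StrictMono σ) : σ = 1 := by
  have : h.orderIsoOfSurjective σ σ.surjective = OrderIso.refl _ := Subsingleton.elim _ _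
  ext i
  have := congrArg (fun f => f i) this
  simpa using congrArg Fin.val this

lemma perm_eq_one_of_fpair {n : ℕ} (σ : Equiv.Perm (Fin n)) (a : Fin n → ℂ)
    (h : ∀ j i : Fin n, j < i → fpair σ a j i ≠ 1) : σ = 1 := by
  apply perm_eq_one
  intro j i hji
  have := h j i hji
  unfold fpair at this
  by_contra hc
  rcases lt_or_eq_of_le (not_lt.mp hc) with h1 | h1
  · simp [h1] at this
  · exact hji.ne (σ.injective h1).symm

lemma step {n : ℕ} (σ : Equiv.Perm (Fin n)) (a b : Fin n → ℂ) (x y : Fin n)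
    (hxy : (y : ℕ) = x + 1) (hb : ∀ i : Fin n, (1 ≤ (x : ℕ) ∨ y < i) → b i = 1)
    (P Q : Fin n) (hPQ : P < Q) (h : (σ P = x ∧ σ Q = y) ∨ (σ P = y ∧ σ Q = x)) :
    LL (Equiv.swap x y * σ) (fun i => a i * b (σ i)) + fpair σ a P Q =
      LL σ a + fpair (Equiv.swap x y * σ) (fun i => a i * b (σ i)) P Q := by
  have hmem : (P, Q) ∈ prs n := by simp [prs, hPQ]
  unfold LL
  rw [← Finset.add_sum_erase _ _ hmem, ← Finset.add_sum_erase (a := (P, Q)) (prs n) _ hmem]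
  have : ∑ p ∈ (prs n).erase (P, Q), fpair (Equiv.swap x y * σ) (fun i => a i * b (σ i)) p.1 p.2
      = ∑ p ∈ (prs n).erase (P, Q), fpair σ a p.1 p.2 := by
    refine Finset.sum_congr rfl ?_
    rintro ⟨j, i⟩ hp
    simp only [prs, Finset.mem_erase, Finset.mem_filter, Finset.mem_univ, true_and, ne_eq,
      Prod.mk.injEq] at hp
    obtain ⟨hne, hlt⟩ := hp
    have hji : σ j ≠ σ i := fun hh => hlt.ne (σ.injective hh)
    have hnp : ¬ (σ j = x ∧ σ i = y) ∧ ¬ (σ j = y ∧ σ i = x) := by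
      constructor <;> rintro ⟨h1, h2⟩ <;> rcases h with ⟨h3, h4⟩ | ⟨h3, h4⟩
      · exact hne ⟨σ.injective (h1.trans h3.symm), σ.injective (h2.trans h4.symm)⟩
      · have e1 := σ.injective (h1.trans h4.symm)
        have e2 := σ.injective (h2.trans h3.symm)
        subst e1 e2; exact absurd hlt (not_lt.mpr hPQ.le)
      · have e1 := σ.injective (h1.trans h4.symm)
        have e2 := σ.injective (h2.trans h3.symm)
        subst e1 e2; exact absurd hlt (not_lt.mpr hPQ.le)
      · exact hne ⟨σ.injective (h1.trans h3.symm), σ.injective (h2.trans h4.symm)⟩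
    have hord : (Equiv.swap x y (σ i) < Equiv.swap x y (σ j)) ↔ σ i < σ j := by
      generalize σ i = u at *
      generalize σ j = v at *
      simp only [Equiv.swap_apply_def]
      simp only [Fin.ext_iff, ne_eq] at hnp hji
      split_ifs <;> simp only [Fin.lt_def, Fin.ext_iff] at * <;> omega
    simp only [fpair, Equiv.Perm.mul_apply, hord]
    by_cases h1 : σ i < σ j
    · simp [h1]
    · have : b (σ i) = 1 := by
        apply hb
        generalize σ i = u at *
        generalize σ j = v at *
        simp only [Fin.lt_def, Fin.ext_iff, ne_eq] at *
        omega
      simp [h1, this]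
  rw [this]; ring

/-- Phases of `t_k`. -/
def tb (de n k : ℕ) : Fin n → ℂ := fun i =>
  if (i : ℕ) = 0 then (zetaC de ^ k)⁻¹ else if (i : ℕ) = 1 then zetaC de ^ k else 1

lemma tMat_eq (de n k : ℕ) (x y : Fin n) (hx : (x : ℕ) = 0) (hy : (y : ℕ) = 1) :
    tMat de n k = M (Equiv.swap x y) (tb de n k) := by
  ext i j
  simp only [tMat, M, tb, Matrix.of_apply, Equiv.swap_apply_def, Fin.ext_iff, hx, hy]
  by_cases h0 : (i : ℕ) = 0
  · simp [h0]
    split_ifs <;> simp_all <;> omega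
  by_cases h1 : (i : ℕ) = 1
  · simp [h1, hx]
  · have : 2 ≤ (i : ℕ) := by omega
    simp [h0, h1, this, eq_comm]

lemma sMat_eq (n j : ℕ) (x y : Fin n) (hj : 3 ≤ j) (hx : (x : ℕ) = j - 2) (hy : (y : ℕ) = j - 1) :
    sMat n j = M (Equiv.swap x y) (fun _ => 1) := by
  ext a b
  simp only [sMat, M, Matrix.of_apply, Equiv.swap_apply_def, Fin.ext_iff, ← hx, ← hy]
  have : (x : ℕ) ≠ y := by omega
  split_ifs <;> first | rfl | (exfalso; omega)

/-- Phases of `z`. -/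
def zb (d n : ℕ) : Fin n → ℂ := fun i => if (i : ℕ) = 0 then zetaC d else 1

lemma zMat_eq (d n : ℕ) : zMat d n = M 1 (zb d n) := by
  ext i j
  simp only [zMat, M, zb, Matrix.of_apply, Equiv.Perm.one_apply, eq_comm]

lemma LL_z {n : ℕ} (d : ℕ) (σ : Equiv.Perm (Fin n)) (a : Fin n → ℂ) :
    LL σ (fun i => a i * zb d n (σ i)) = LL σ a := by
  refine Finset.sum_congr rfl ?_
  rintro ⟨j, i⟩ hp
  simp only [prs, Finset.mem_filter, Finset.mem_univ, true_and] at hp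
  simp only [fpair]
  by_cases h1 : σ i < σ j
  · simp [h1]
  · have hji : σ j ≠ σ i := fun hh => hp.ne (σ.injective hh)
    have : (σ i : ℕ) ≠ 0 := by
      simp only [Fin.lt_def, Fin.ext_iff, ne_eq] at *
      omega
    simp [h1, zb, this]

lemma prod_two {n : ℕ} (g : Fin n → ℂ) (x y : Fin n) (hx : (x : ℕ) = 0) (hy : (y : ℕ) = 1)
    (h : ∀ i : Fin n, 2 ≤ (i : ℕ) → g i = 1) : ∏ i, g i = g x * g y := by
  have hne : x ≠ y := by intro h; rw [Fin.ext_iff] at h; omega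
  rw [← Finset.prod_pair hne]
  symm
  apply Finset.prod_subset (Finset.subset_univ _)
  intro i _ hi
  apply h
  simp only [Finset.mem_insert, Finset.mem_singleton, Fin.ext_iff] at hi
  omega

lemma prod_tb (de n k : ℕ) (hde : de ≠ 0) (hn : 2 ≤ n) : ∏ i, tb de n k i = 1 := by
  rw [prod_two (tb de n k) ⟨0, by omega⟩ ⟨1, by omega⟩ rfl rfl]
  · have : zetaC de ^ k ≠ 0 := pow_ne_zero _ ((zeta_prim de hde).ne_zero hde)
    simp [tb, this]
  · intro i hi
    have h0 : (i : ℕ) ≠ 0 := by omega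
    have h1 : (i : ℕ) ≠ 1 := by omega
    simp [tb, h0, h1]

lemma prod_zb (d n : ℕ) (hn : 2 ≤ n) : ∏ i, zb d n i = zetaC d := by
  rw [prod_two (zb d n) ⟨0, by omega⟩ ⟨1, by omega⟩ rfl rfl]
  · simp [zb]
  · intro i hi
    have h0 : (i : ℕ) ≠ 0 := by omega
    simp [zb, h0]

lemma prod_twist {n : ℕ} (σ : Equiv.Perm (Fin n)) (a b : Fin n → ℂ) :
    ∏ i, (a i * b (σ i)) = (∏ i, a i) * ∏ i, b i := by
  rw [Finset.prod_mul_distrib, Equiv.prod_comp σ b]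

/-- `x` is a non-`z` generator. -/
def Refl (d e n : ℕ) (x y : Fin n) (b : Fin n → ℂ) : Prop :=
  (y : ℕ) = x + 1 ∧ (∀ i : Fin n, (1 ≤ (x : ℕ) ∨ y < i) → b i = 1) ∧
  M (Equiv.swap x y) b ∈ genX d e n ∧ ∏ i, b i = 1 ∧ (∀ i, b i ^ (d * e) = 1) ∧
  M (Equiv.swap x y) b * M (Equiv.swap x y) b = 1

lemma refl_t (d e n k : ℕ) (hde : d * e ≠ 0) (hn : 2 ≤ n) (hk : k < d * e) (x y : Fin n)
    (hx : (x : ℕ) = 0) (hy : (y : ℕ) = 1) : Refl d e n x y (tb (d * e) n k) := by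
  have hz : zetaC (d * e) ^ k ≠ 0 := pow_ne_zero _ ((zeta_prim _ hde).ne_zero hde)
  refine ⟨by omega, ?_, ?_, prod_tb _ _ _ hde hn, ?_, ?_⟩
  · intro i hi
    rw [Fin.lt_def] at hi
    have h0 : (i : ℕ) ≠ 0 := by omega
    have h1 : (i : ℕ) ≠ 1 := by omega
    simp [tb, h0, h1]
  · left; right; exact ⟨k, hk, (tMat_eq _ _ _ _ _ hx hy).symm⟩
  · intro i
    have h1 : (zetaC (d * e) ^ k) ^ (d * e) = 1 := by
      rw [← pow_mul, mul_comm k, pow_mul, (zeta_prim _ hde).pow_eq_one, one_pow]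
    unfold tb
    split_ifs <;> simp [h1]
  · rw [M_mul, Equiv.swap_mul_self, ← M_one]
    congr 1
    funext i
    by_cases h0 : i = x
    · subst h0; simp [tb, hx, hy, hz]
    by_cases h1 : i = y
    · subst h1; simp [tb, hx, hy, hz]
    rw [Equiv.swap_apply_of_ne_of_ne h0 h1]
    rw [Fin.ext_iff, hx] at h0
    rw [Fin.ext_iff, hy] at h1
    simp [tb, h0, h1]

lemma refl_s (d e n : ℕ) (x y : Fin n) (hxy : (y : ℕ) = x + 1)
    (hx : 1 ≤ (x : ℕ)) : Refl d e n x y (fun _ => 1) := by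
  refine ⟨hxy, by simp, ?_, by simp, by simp, ?_⟩
  · right
    exact ⟨x + 2, by omega, by omega, (sMat_eq _ _ _ _ (by omega) (by omega) (by omega)).symm⟩
  · rw [M_mul, Equiv.swap_mul_self, ← M_one]; simp

lemma gen_cases (d e n : ℕ) (hde : d * e ≠ 0) (hn : 2 ≤ n) (g : Matrix (Fin n) (Fin n) ℂ)
    (hg : g ∈ genX d e n) : g = M 1 (zb d n) ∨
      ∃ x y b, Refl d e n x y b ∧ g = M (Equiv.swap x y) b := by
  rcases hg with (hg | ⟨k, hk, rfl⟩) | ⟨j, h3, hj, rfl⟩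
  · left; rw [← zMat_eq]; exact hg
  · right
    exact ⟨⟨0, by omega⟩, ⟨1, by omega⟩, _, refl_t d e n k hde hn hk _ _ rfl rfl,
      tMat_eq _ _ _ _ _ rfl rfl⟩
  · right
    exact ⟨⟨j - 2, by omega⟩, ⟨j - 1, by omega⟩, _,
      refl_s d e n _ _ (by simp only; omega) (by simp only; omega), sMat_eq _ _ _ _ h3 rfl rfl⟩

lemma LL_step_le {d e n : ℕ} {x y : Fin n} {b : Fin n → ℂ} (h : Refl d e n x y b)
    (σ : Equiv.Perm (Fin n)) (a : Fin n → ℂ) :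
    LL (Equiv.swap x y * σ) (fun i => a i * b (σ i)) ≤ LL σ a + 1 := by
  obtain ⟨hxy, hb, -⟩ := h
  have hlt : x < y := by rw [Fin.lt_def]; omega
  rcases lt_trichotomy (σ.symm x) (σ.symm y) with h | h | h
  · have := step σ a b x y hxy hb _ _ h (Or.inl (by simp))
    simp only [fpair, Equiv.Perm.mul_apply, Equiv.apply_symm_apply, Equiv.swap_apply_left,
      Equiv.swap_apply_right, hlt, not_lt.mpr hlt.le, if_true, if_false] at this
    omega
  · exact absurd (σ.symm.injective h) hlt.ne
  · have := step σ a b x y hxy hb _ _ h (Or.inr (by simp))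
    simp only [fpair, Equiv.Perm.mul_apply, Equiv.apply_symm_apply, Equiv.swap_apply_left,
      Equiv.swap_apply_right, hlt, not_lt.mpr hlt.le, if_true, if_false] at this
    split_ifs at this <;> omega

/-- Lower bound: what a word can produce. -/
lemma word_lower (d e n : ℕ) (hde : d * e ≠ 0) (hn : 2 ≤ n)
    (l : List (Matrix (Fin n) (Fin n) ℂ)) (hl : ∀ x ∈ l, x ∈ genX d e n) :
    ∃ σ a p q, l.prod = M σ a ∧ p + q = l.length ∧ LL σ a ≤ p ∧ ∏ i, a i = zetaC d ^ q := by
  induction l using List.reverseRecOn with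
  | nil =>
    refine ⟨1, fun _ => 1, 0, 0, by simp [M_one], rfl, ?_, by simp⟩
    rw [Nat.le_zero, LL_eq_zero_iff]
    intro j i hji
    simp [fpair, hji.le]
  | append_singleton l g ih =>
    obtain ⟨σ, a, p, q, h1, h2, h3, h4⟩ := ih fun x hx => hl x (by simp [hx])
    rcases gen_cases d e n hde hn g (hl g (by simp)) with rfl | ⟨x, y, b, hR, rfl⟩
    · refine ⟨1 * σ, fun i => a i * zb d n (σ i), p, q + 1, ?_, ?_, ?_, ?_⟩
      · rw [List.prod_append, h1, List.prod_singleton, M_mul]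
      · simp; omega
      · rw [one_mul, LL_z]; exact h3
      · rw [prod_twist, h4, prod_zb d n hn, pow_succ]
    · refine ⟨_, _, p + 1, q, ?_, ?_, (LL_step_le hR σ a).trans (by omega), ?_⟩
      · rw [List.prod_append, h1, List.prod_singleton, M_mul]
      · simp; omega
      · rw [prod_twist, h4, hR.2.2.2.1, mul_one]

lemma descent_or (d e n : ℕ) (hde : d * e ≠ 0) (hn : 2 ≤ n) (σ : Equiv.Perm (Fin n))
    (a : Fin n → ℂ) (ha : ∀ i, a i ^ (d * e) = 1) (hL : LL σ a ≠ 0) :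
    ∃ x y b, Refl d e n x y b ∧
      LL (Equiv.swap x y * σ) (fun i => a i * b (σ i)) + 1 = LL σ a := by
  by_contra hc
  push Not at hc
  have key : ∀ m (hm : m + 1 < n), σ.symm ⟨m, by omega⟩ < σ.symm ⟨m + 1, hm⟩ ∧
      a (σ.symm ⟨m + 1, hm⟩) = 1 := by
    intro m
    induction m with
    | zero =>
      intro hm
      set x : Fin n := ⟨0, by omega⟩ with hx
      set y : Fin n := ⟨0 + 1, hm⟩ with hy
      have hlt : x < y := by rw [Fin.lt_def]; simp [hx, hy]
      rcases lt_trichotomy (σ.symm x) (σ.symm y) with h | h | h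
      · refine ⟨h, ?_⟩
        by_contra hne
        have hR := refl_t d e n 0 hde hn (by omega) x y rfl rfl
        have := step σ a _ x y hR.1 hR.2.1 _ _ h (Or.inl (by simp))
        simp only [fpair, Equiv.Perm.mul_apply, Equiv.apply_symm_apply, Equiv.swap_apply_left,
          Equiv.swap_apply_right, hlt, not_lt.mpr hlt.le, if_true, if_false, hne] at this
        exact hc _ _ _ hR (by omega)
      · exact absurd (σ.symm.injective h) hlt.ne
      · exfalso
        have : NeZero (d * e) := ⟨hde⟩
        obtain ⟨k, hk, hk2⟩ := (zeta_prim _ hde).eq_pow_of_pow_eq_one (ha (σ.symm x))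
        have hR := refl_t d e n k hde hn hk x y rfl rfl
        have := step σ a _ x y hR.1 hR.2.1 _ _ h (Or.inr (by simp))
        have hz : zetaC (d * e) ^ k ≠ 0 := pow_ne_zero _ ((zeta_prim _ hde).ne_zero hde)
        have h1 : a (σ.symm x) * tb (d * e) n k x = 1 := by
          rw [← hk2]; simp [tb, hx, hz]
        simp only [fpair, Equiv.Perm.mul_apply, Equiv.apply_symm_apply, Equiv.swap_apply_left,
          Equiv.swap_apply_right, hlt, not_lt.mpr hlt.le, if_true, if_false, h1] at this
        exact hc _ _ _ hR (by omega)
    | succ m ih =>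
      intro hm
      obtain ⟨-, ih⟩ := ih (by omega)
      set x : Fin n := ⟨m + 1, by omega⟩ with hx
      set y : Fin n := ⟨m + 1 + 1, hm⟩ with hy
      have hlt : x < y := by rw [Fin.lt_def]; simp [hx, hy]
      have hR := refl_s d e n x y rfl (by simp [hx])
      rcases lt_trichotomy (σ.symm x) (σ.symm y) with h | h | h
      · refine ⟨h, ?_⟩
        by_contra hne
        have := step σ a _ x y hR.1 hR.2.1 _ _ h (Or.inl (by simp))
        simp only [fpair, Equiv.Perm.mul_apply, Equiv.apply_symm_apply, Equiv.swap_apply_left,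
          Equiv.swap_apply_right, hlt, not_lt.mpr hlt.le, if_true, if_false, hne] at this
        exact hc _ _ _ hR (by omega)
      · exact absurd (σ.symm.injective h) hlt.ne
      · exfalso
        have := step σ a _ x y hR.1 hR.2.1 _ _ h (Or.inr (by simp))
        have h1 : a (σ.symm x) * 1 = 1 := by rw [ih, mul_one]
        simp only [fpair, Equiv.Perm.mul_apply, Equiv.apply_symm_apply, Equiv.swap_apply_left,
          Equiv.swap_apply_right, hlt, not_lt.mpr hlt.le, if_true, if_false, h1] at this
        exact hc _ _ _ hR (by omega)
  have mono : StrictMono σ.symm := by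
    obtain ⟨m, rfl⟩ : ∃ m, n = m + 1 := ⟨n - 1, by omega⟩
    rw [Fin.strictMono_iff_lt_succ]
    intro i
    exact (key i (by omega)).1
  have h1 := perm_eq_one _ mono
  have h2 : σ = 1 := by
    rw [Equiv.ext_iff] at h1 ⊢
    intro i
    have := h1 (σ i)
    simpa using this.symm
  subst h2
  apply hL
  rw [LL_eq_zero_iff]
  intro j i hji
  have : a i = 1 := by
    have hi : (i : ℕ) ≠ 0 := by rw [Fin.lt_def] at hji; omega
    have := (key (i - 1) (by omega)).2
    have hi2 : (⟨(i : ℕ) - 1 + 1, by omega⟩ : Fin n) = i := by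
      rw [Fin.ext_iff]; simp only; omega
    rw [hi2] at this
    exact this
  simp [fpair, this, hji.le]

lemma z_pow (d n k : ℕ) : (zMat d n) ^ k =
    M 1 (fun i : Fin n => if (i : ℕ) = 0 then zetaC d ^ k else 1) := by
  induction k with
  | zero => simp [M_one]
  | succ k ih =>
    rw [pow_succ, ih, zMat_eq, M_mul, one_mul]
    congr 1
    funext i
    simp only [zb, Equiv.Perm.one_apply]
    by_cases h : (i : ℕ) = 0 <;> simp [h, pow_succ]

lemma word_upper (d e n : ℕ) (hde : d * e ≠ 0) (hn : 2 ≤ n) (k : ℕ) (N : ℕ) :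
    ∀ (σ : Equiv.Perm (Fin n)) (a : Fin n → ℂ), (∀ i, a i ^ (d * e) = 1) →
      ∏ i, a i = zetaC d ^ k → LL σ a = N →
      ∃ l : List (Matrix (Fin n) (Fin n) ℂ), (∀ x ∈ l, x ∈ genX d e n) ∧ l.length = N + k ∧
        l.prod = M σ a := by
  induction N with
  | zero =>
    intro σ a ha hk hL
    rw [LL_eq_zero_iff] at hL
    have h1 := perm_eq_one_of_fpair σ a fun j i hji => by rw [hL j i hji]; omega
    subst h1
    have h2 : ∀ i : Fin n, (i : ℕ) ≠ 0 → a i = 1 := by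
      intro i hi
      have hlt : (⟨0, by omega⟩ : Fin n) < i := by rw [Fin.lt_def]; simp only; omega
      have := hL ⟨0, by omega⟩ i hlt
      by_contra hne
      simp only [fpair, hne, if_false] at this
      split_ifs at this
    rw [prod_two a ⟨0, by omega⟩ ⟨1, by omega⟩ rfl rfl fun i hi => h2 i (by omega),
      h2 ⟨1, by omega⟩ (by simp), mul_one] at hk
    refine ⟨List.replicate k (zMat d n), ?_, by simp, ?_⟩
    · intro x hx
      rw [List.eq_of_mem_replicate hx]
      left; left; rfl
    · rw [List.prod_replicate, z_pow]
      congr 1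
      funext i
      split_ifs with h
      · rw [← hk]; congr 1; exact Fin.ext h.symm
      · exact (h2 i h).symm
  | succ N ih =>
    intro σ a ha hk hL
    obtain ⟨x, y, b, hR, h⟩ := descent_or d e n hde hn σ a ha (by omega)
    obtain ⟨l, h1, h2, h3⟩ := ih (Equiv.swap x y * σ) (fun i => a i * b (σ i))
      (fun i => by rw [mul_pow, ha, hR.2.2.2.2.1, one_mul])
      (by rw [prod_twist, hk, hR.2.2.2.1, mul_one]) (by omega)
    refine ⟨l ++ [M (Equiv.swap x y) b], ?_, ?_, ?_⟩
    · intro g hg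
      rcases List.mem_append.mp hg with hg | hg
      · exact h1 g hg
      · rw [List.mem_singleton.mp hg]; exact hR.2.2.1
    · simp; omega
    · rw [List.prod_append, h3, List.prod_singleton, ← M_mul, mul_assoc, hR.2.2.2.2.2, mul_one]

lemma M_inj {n : ℕ} (σ τ : Equiv.Perm (Fin n)) (a b : Fin n → ℂ) (ha : ∀ i, a i ≠ 0)
    (h : M σ a = M τ b) : σ = τ ∧ a = b := by
  have h1 : ∀ i, σ i = τ i := by
    intro i
    by_contra hne
    have := congrFun (congrFun h i) (σ i)
    simp [M, hne, ha] at this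
  refine ⟨Equiv.ext h1, ?_⟩
  funext i
  have := congrFun (congrFun h i) (σ i)
  simpa [M, h1] using this

lemma len_eq (d e n : ℕ) (hde : d * e ≠ 0) (hn : 2 ≤ n) (k : ℕ) (hk : k < d)
    (σ : Equiv.Perm (Fin n)) (a : Fin n → ℂ) (ha : ∀ i, a i ^ (d * e) = 1)
    (hp : ∏ i, a i = zetaC d ^ k) : len (genX d e n) (M σ a) = LL σ a + k := by
  have hd : d ≠ 0 := by omega
  apply le_antisymm
  · exact Nat.sInf_le (word_upper d e n hde hn k _ σ a ha hp rfl)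
  · apply le_csInf
    · exact ⟨_, word_upper d e n hde hn k _ σ a ha hp rfl⟩
    · rintro m ⟨l, hl, rfl, hprod⟩
      obtain ⟨τ, b, p, q, h1, h2, h3, h4⟩ := word_lower d e n hde hn l hl
      have ha0 : ∀ i, a i ≠ 0 := by
        intro i h0
        have := ha i
        simp [h0, zero_pow hde] at this
      obtain ⟨rfl, rfl⟩ := M_inj σ τ a b ha0 (hprod.symm.trans h1)
      rw [h4] at hp
      have h6 : k ≤ q := by
        by_contra hlt
        have := (zeta_prim d hd).pow_inj (by omega) hk hp
        omega
      omega

lemma G_cases (d e n : ℕ) (hd : d ≠ 0) (w : Matrix (Fin n) (Fin n) ℂ) (hw : w ∈ Gdeen d e n) :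
    ∃ σ a k, w = M σ a ∧ (∀ i, a i ^ (d * e) = 1) ∧ k < d ∧ ∏ i, a i = zetaC d ^ k := by
  obtain ⟨σ, h1, h2, h3⟩ := hw
  have : NeZero d := ⟨hd⟩
  obtain ⟨k, hk, hk2⟩ := (zeta_prim d hd).eq_pow_of_pow_eq_one h3
  refine ⟨σ, fun i => w i (σ i), k, ?_, h2, hk, hk2.symm⟩
  ext i j
  simp only [M, Matrix.of_apply]
  split_ifs with h
  · rw [h]
  · by_contra h0
    exact h ((h1 i j).mp h0)

lemma len_le (d e n : ℕ) (hde : d * e ≠ 0) (hd : d ≠ 0) (hn : 2 ≤ n)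
    (w : Matrix (Fin n) (Fin n) ℂ) (hw : w ∈ Gdeen d e n) :
    len (genX d e n) w ≤ n * (n - 1) + d - 1 := by
  obtain ⟨σ, a, k, rfl, ha, hk, hp⟩ := G_cases d e n hd w hw
  rw [len_eq d e n hde hn k hk σ a ha hp]
  have := LL_le σ a
  omega

lemma set_eq (d e n : ℕ) (hde : d * e ≠ 0) (hd : d ≠ 0) (hn : 2 ≤ n) :
    {w ∈ Gdeen d e n | len (genX d e n) w = n * (n - 1) + d - 1} =
      {w ∈ Gdeen d e n |
        (∀ i j : Fin n, i ≠ j → w i j = 0) ∧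
        (∀ i : Fin n, 1 ≤ (i : ℕ) → (w i i) ^ (d * e) = 1 ∧ w i i ≠ 1) ∧
        (∏ i, w i i) = zetaC d ^ (d - 1)} := by
  ext w
  simp only [Set.mem_setOf_eq]
  refine and_congr_right fun hw => ?_
  obtain ⟨σ, a, k, rfl, ha, hk, hp⟩ := G_cases d e n hd w hw
  rw [len_eq d e n hde hn k hk σ a ha hp]
  have hle := LL_le σ a
  constructor
  · intro h
    have h1 : LL σ a = n * (n - 1) := by omega
    have h2 : k = d - 1 := by omega
    rw [LL_eq_max_iff] at h1
    have h3 := perm_eq_one_of_fpair σ a fun j i hji => by rw [h1 j i hji]; omega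
    subst h3
    refine ⟨?_, ?_, ?_⟩
    · intro i j hij
      simp [M, hij.symm]
    · intro i hi
      refine ⟨by simp [M, ha], ?_⟩
      have := h1 ⟨0, by omega⟩ i (by rw [Fin.lt_def]; simp only; omega)
      intro hne
      simp [M] at hne
      simp only [fpair, hne] at this
      split_ifs at this <;> omega
    · simp [M, hp, h2]
  · rintro ⟨h1, h2, h3⟩
    have ha0 : ∀ i, a i ≠ 0 := by
      intro i h0
      have := ha i
      simp [h0, zero_pow hde] at this
    have hs : σ = 1 := by
      ext i
      by_contra hne
      have := h1 i (σ i) (fun h => hne (by rw [← h]; rfl))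
      simp [M, ha0] at this
    subst hs
    simp only [M, Matrix.of_apply, Equiv.Perm.one_apply, if_true] at h2 h3
    have h4 : LL 1 a = n * (n - 1) := by
      rw [LL_eq_max_iff]
      intro j i hji
      have hi : 1 ≤ (i : ℕ) := by rw [Fin.lt_def] at hji; omega
      simp [fpair, hji.le, (h2 i hi).2]
    have h5 : k = d - 1 :=
      (zeta_prim d hd).pow_inj hk (by omega) (hp.symm.trans h3)
    omega

lemma ncard_eq (d e n : ℕ) (hde : d * e ≠ 0) (hd : d ≠ 0) (hn : 2 ≤ n) :
    {w ∈ Gdeen d e n |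
        (∀ i j : Fin n, i ≠ j → w i j = 0) ∧
        (∀ i : Fin n, 1 ≤ (i : ℕ) → (w i i) ^ (d * e) = 1 ∧ w i i ≠ 1) ∧
        (∏ i, w i i) = zetaC d ^ (d - 1)}.ncard = (d * e - 1) ^ (n - 1) := by
  classical
  obtain ⟨m, rfl⟩ : ∃ m, n = m + 1 := ⟨n - 1, by omega⟩
  set R : Finset ℂ := (Polynomial.nthRootsFinset (d * e) (1 : ℂ)).erase 1 with hR
  have hmem : ∀ x, x ∈ R ↔ x ≠ 1 ∧ x ^ (d * e) = 1 := by
    intro x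
    rw [hR, Finset.mem_erase, Polynomial.mem_nthRootsFinset (Nat.pos_of_ne_zero hde)]
  have hcard : R.card = d * e - 1 := by
    rw [hR, Finset.card_erase_of_mem, (zeta_prim _ hde).card_nthRootsFinset]
    rw [Polynomial.mem_nthRootsFinset (Nat.pos_of_ne_zero hde)]; simp
  set F : (Fin m → ℂ) → Matrix (Fin (m + 1)) (Fin (m + 1)) ℂ := fun g =>
    Matrix.diagonal (Fin.cons (zetaC d ^ (d - 1) / ∏ i, g i) g) with hF
  have hinj : Function.Injective F := by
    intro g g' h
    have := Matrix.diagonal_injective h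
    exact (Fin.cons_injective2 this).2
  have hz : (zetaC d ^ (d - 1)) ^ d = 1 := by
    rw [← pow_mul, mul_comm, pow_mul, (zeta_prim d hd).pow_eq_one, one_pow]
  have himg : {w ∈ Gdeen d e (m + 1) |
        (∀ i j : Fin (m + 1), i ≠ j → w i j = 0) ∧
        (∀ i : Fin (m + 1), 1 ≤ (i : ℕ) → (w i i) ^ (d * e) = 1 ∧ w i i ≠ 1) ∧
        (∏ i, w i i) = zetaC d ^ (d - 1)} = F '' ↑(Fintype.piFinset (fun _ : Fin m => R)) := by
    ext w
    simp only [Set.mem_setOf_eq, Set.mem_image, Finset.mem_coe, Fintype.mem_piFinset, hmem]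
    constructor
    · rintro ⟨-, h1, h2, h3⟩
      refine ⟨fun i => w i.succ i.succ, fun i => (h2 i.succ (by simp)).symm, ?_⟩
      have hne : ∏ i : Fin m, w i.succ i.succ ≠ 0 := by
        rw [Finset.prod_ne_zero_iff]
        intro i _ h0
        have := (h2 i.succ (by simp)).1
        simp [h0, zero_pow hde] at this
      rw [Fin.prod_univ_succ] at h3
      ext i j
      by_cases hij : i = j
      · subst hij
        simp only [hF, Matrix.diagonal_apply_eq]
        refine Fin.cases ?_ (fun i => ?_) i
        · simp only [Fin.cons_zero]
          rw [← h3]; field_simp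
        · simp
      · rw [h1 i j hij]
        exact Matrix.diagonal_apply_ne _ hij
    · rintro ⟨g, hg, rfl⟩
      have hg0 : ∀ i, g i ≠ 0 := by
        intro i h0
        have := (hg i).2
        simp [h0, zero_pow hde] at this
      have hne : ∏ i : Fin m, g i ≠ 0 := Finset.prod_ne_zero_iff.mpr fun i _ => hg0 i
      have hpr : ∏ i, F g i i = zetaC d ^ (d - 1) := by
        simp only [hF, Matrix.diagonal_apply_eq]
        rw [Fin.prod_univ_succ]
        simp only [Fin.cons_zero, Fin.cons_succ]
        field_simp
      have hroot : ∀ i, F g i i ^ (d * e) = 1 := by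
        intro i
        simp only [hF, Matrix.diagonal_apply_eq]
        refine Fin.cases ?_ (fun i => ?_) i
        · simp only [Fin.cons_zero]
          rw [div_pow, pow_mul, hz, one_pow, ← Finset.prod_pow]
          simp [(hg _).2]
        · simp [(hg _).2]
      refine ⟨⟨1, ?_, ?_, ?_⟩, ?_, ?_, hpr⟩
      · intro i j
        constructor
        · intro h
          by_contra hne
          exact h (Matrix.diagonal_apply_ne _ (fun h => hne h.symm))
        · intro h h0
          simp only [Equiv.Perm.one_apply] at h
          subst h
          have := hroot j
          simp [h0, zero_pow hde] at this
      · exact hroot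
      · simp only [Equiv.Perm.one_apply]
        rw [hpr, hz]
      · intro i j hij
        exact Matrix.diagonal_apply_ne _ hij
      · intro i hi
        refine ⟨hroot i, ?_⟩
        obtain ⟨i', rfl⟩ := Fin.exists_succ_eq.mpr (show i ≠ 0 by
          rintro rfl; simp at hi)
        simp only [hF, Matrix.diagonal_apply_eq, Fin.cons_succ]
        exact (hg i').1
  rw [himg, Set.ncard_image_of_injective _ hinj, Set.ncard_coe_finset, Fintype.card_piFinset_const,
    hcard]
  simp

end GD

/-- The set of elements of `G(de,e,n)` of maximal length `n(n-1) + d - 1`: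
they are exactly the diagonal matrices whose diagonal entries in positions `2, …, n`
are nontrivial `de`-th roots of unity and whose product of diagonal entries is
`ζ_d^{d-1}`; there are `(de-1)^{n-1}` of them. -/
theorem max_length_in_Gdeen (d e n : ℕ) (hd : 1 < d) (he : 1 < e) (hn : 2 ≤ n) :
    IsGreatest (len (genX d e n) '' Gdeen d e n) (n * (n - 1) + d - 1) ∧
    {w ∈ Gdeen d e n | len (genX d e n) w = n * (n - 1) + d - 1} =
      {w ∈ Gdeen d e n |
        (∀ i j : Fin n, i ≠ j → w i j = 0) ∧
        (∀ i : Fin n, 1 ≤ (i : ℕ) → (w i i) ^ (d * e) = 1 ∧ w i i ≠ 1) ∧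
        (∏ i, w i i) = zetaC d ^ (d - 1)} ∧
    {w ∈ Gdeen d e n | len (genX d e n) w = n * (n - 1) + d - 1}.ncard =
      (d * e - 1) ^ (n - 1) := by
  have hd0 : d ≠ 0 := by omega
  have hde : d * e ≠ 0 := Nat.mul_ne_zero hd0 (by omega)
  have hset := GD.set_eq d e n hde hd0 hn
  have hcard := GD.ncard_eq d e n hde hd0 hn
  refine ⟨⟨?_, ?_⟩, hset, hset ▸ hcard⟩
  · rw [← hset] at hcard
    have hpos : 0 < (d * e - 1) ^ (n - 1) := by
      apply pow_pos
      have : 1 * 1 < d * e := Nat.mul_lt_mul'' hd he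
      omega
    rw [← hcard] at hpos
    obtain ⟨w, hw, hl⟩ := Set.nonempty_of_ncard_ne_zero hpos.ne'
    exact ⟨w, hw, hl⟩
  · rintro _ ⟨w, hw, rfl⟩
    exact GD.len_le d e n hde hd0 hn w hw
end
end

section
/- Let d > 1 and n ≥ 2. Let Γ₁ be the group presented by generators z, t₀, t₁, …, t_{d−1} (indices taken modulo d), s₃, …, sₙ and relations: z tᵢ = t_{i−1} z for all i; z s_j = s_j z for 3 ≤ j ≤ n; tᵢ t_{i−1} = t_j t_{j−1} for all i, j; tᵢ s₃ tᵢ = s₃ tᵢ s₃ for all i; s_j tᵢ = tᵢ s_j for all i and 4 ≤ j ≤ n; sᵢ s_{i+1} sᵢ = s_{i+1} sᵢ s_{i+1} for 3 ≤ i ≤ n−1; sᵢ s_j = s_j sᵢ for 3 ≤ i, j ≤ n with |i−j| > 1; z^d = 1; tᵢ² = 1 for all i; s_j² = 1 for 3 ≤ j ≤ n. Let Γ₂ be the group presented by generators z, s₂, s₃, …, sₙ and relations: z s₂ z s₂ = s₂ z s₂ z; z s_j = s_j z for 3 ≤ j ≤ n; sᵢ s_{i+1} sᵢ = s_{i+1}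 sᵢ s_{i+1} for 2 ≤ i ≤ n−1; sᵢ s_j = s_j sᵢ for 2 ≤ i, j ≤ n with |i−j| > 1; z^d = 1; s_j² = 1 for 2 ≤ j ≤ n. Then there is a group isomorphism Γ₁ ≅ Γ₂ sending z ↦ z, s_j ↦ s_j for 3 ≤ j ≤ n, and t_k ↦ z^{−k} s₂ z^k for 0 ≤ k ≤ d−1. -/
noncomputable section

/-- Generators of the Corran–Lee–Lee presentation of `G(d,1,n)`:
`z`, `t_i` for `i` modulo `d`, and `s_j` for `3 ≤ j ≤ n`. -/
inductive Gen1 (d n : ℕ) : Type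
  | z : Gen1 d n
  | t : ZMod d → Gen1 d n
  | s : (j : ℕ) → 3 ≤ j → j ≤ n → Gen1 d n

/-- Generators of the classical presentation of `G(d,1,n)`:
`z` and `s_j` for `2 ≤ j ≤ n`. -/
inductive Gen2 (n : ℕ) : Type
  | z : Gen2 n
  | s : (j : ℕ) → 2 ≤ j → j ≤ n → Gen2 n

open FreeGroup

/-- The relators of the Corran–Lee–Lee presentation (each relation `u = v`
is recorded as the relator `u * v⁻¹`). -/
inductive Rels1 (d n : ℕ) : FreeGroup (Gen1 d n) → Prop
  | zt (i : ZMod d) :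
      Rels1 d n (of Gen1.z * of (Gen1.t i) * (of (Gen1.t (i - 1)) * of Gen1.z)⁻¹)
  | zs (j : ℕ) (h3 : 3 ≤ j) (hn : j ≤ n) :
      Rels1 d n (of Gen1.z * of (Gen1.s j h3 hn) * (of (Gen1.s j h3 hn) * of Gen1.z)⁻¹)
  | tt (i j : ZMod d) :
      Rels1 d n (of (Gen1.t i) * of (Gen1.t (i - 1)) *
        (of (Gen1.t j) * of (Gen1.t (j - 1)))⁻¹)
  | tst (i : ZMod d) (h : 3 ≤ n) :
      Rels1 d n (of (Gen1.t i) * of (Gen1.s 3 le_rfl h) * of (Gen1.t i) *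
        (of (Gen1.s 3 le_rfl h) * of (Gen1.t i) * of (Gen1.s 3 le_rfl h))⁻¹)
  | st (i : ZMod d) (j : ℕ) (h3 : 3 ≤ j) (h4 : 4 ≤ j) (hn : j ≤ n) :
      Rels1 d n (of (Gen1.s j h3 hn) * of (Gen1.t i) *
        (of (Gen1.t i) * of (Gen1.s j h3 hn))⁻¹)
  | braid (i : ℕ) (h3 : 3 ≤ i) (h3' : 3 ≤ i + 1) (hn' : i ≤ n) (hn : i + 1 ≤ n) :
      Rels1 d n (of (Gen1.s i h3 hn') * of (Gen1.s (i + 1) h3' hn) * of (Gen1.s i h3 hn') *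
        (of (Gen1.s (i + 1) h3' hn) * of (Gen1.s i h3 hn') * of (Gen1.s (i + 1) h3' hn))⁻¹)
  | comm (i j : ℕ) (h3i : 3 ≤ i) (hni : i ≤ n) (h3j : 3 ≤ j) (hnj : j ≤ n)
      (hij : i + 1 < j ∨ j + 1 < i) :
      Rels1 d n (of (Gen1.s i h3i hni) * of (Gen1.s j h3j hnj) *
        (of (Gen1.s j h3j hnj) * of (Gen1.s i h3i hni))⁻¹)
  | zord : Rels1 d n (of Gen1.z ^ d)
  | tsq (i : ZMod d) : Rels1 d n (of (Gen1.t i) ^ 2)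
  | ssq (j : ℕ) (h3 : 3 ≤ j) (hn : j ≤ n) : Rels1 d n (of (Gen1.s j h3 hn) ^ 2)

/-- The relators of the classical presentation of `G(d,1,n)`. -/
inductive Rels2 (d n : ℕ) : FreeGroup (Gen2 n) → Prop
  | zszs (h : 2 ≤ n) :
      Rels2 d n (of Gen2.z * of (Gen2.s 2 le_rfl h) * of Gen2.z * of (Gen2.s 2 le_rfl h) *
        (of (Gen2.s 2 le_rfl h) * of Gen2.z * of (Gen2.s 2 le_rfl h) * of Gen2.z)⁻¹)
  | zs (j : ℕ) (h2 : 2 ≤ j) (h3 : 3 ≤ j) (hn : j ≤ n) :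
      Rels2 d n (of Gen2.z * of (Gen2.s j h2 hn) * (of (Gen2.s j h2 hn) * of Gen2.z)⁻¹)
  | braid (i : ℕ) (h2 : 2 ≤ i) (h2' : 2 ≤ i + 1) (hn' : i ≤ n) (hn : i + 1 ≤ n) :
      Rels2 d n (of (Gen2.s i h2 hn') * of (Gen2.s (i + 1) h2' hn) * of (Gen2.s i h2 hn') *
        (of (Gen2.s (i + 1) h2' hn) * of (Gen2.s i h2 hn') * of (Gen2.s (i + 1) h2' hn))⁻¹)
  | comm (i j : ℕ) (h2i : 2 ≤ i) (hni : i ≤ n) (h2j : 2 ≤ j) (hnj : j ≤ n)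
      (hij : i + 1 < j ∨ j + 1 < i) :
      Rels2 d n (of (Gen2.s i h2i hni) * of (Gen2.s j h2j hnj) *
        (of (Gen2.s j h2j hnj) * of (Gen2.s i h2i hni))⁻¹)
  | zord : Rels2 d n (of Gen2.z ^ d)
  | ssq (j : ℕ) (h2 : 2 ≤ j) (hn : j ≤ n) : Rels2 d n (of (Gen2.s j h2 hn) ^ 2)

/-- `Γ₁`: the group defined by the Corran–Lee–Lee presentation. -/
abbrev Gamma1 (d n : ℕ) : Type := PresentedGroup (setOf (Rels1 d n))

/-- `Γ₂`: the group defined by the classical presentation. -/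
abbrev Gamma2 (d n : ℕ) : Type := PresentedGroup (setOf (Rels2 d n))

lemma aux_pw {G : Type*} [Group G] {d : ℕ} {a : G} (ha : a ^ d = 1) (i : ZMod d) (k : ℤ)
    (h : (k : ZMod d) = i) : a ^ (i.cast : ℤ) = a ^ k := by
  have h1 : ((i.cast : ℤ) : ZMod d) = (k : ZMod d) := by rw [h]; simp
  rw [ZMod.intCast_eq_intCast_iff_dvd_sub] at h1
  obtain ⟨c, hc⟩ := h1
  have : k = (i.cast : ℤ) + d * c := by omega
  rw [this, zpow_add, zpow_mul, zpow_natCast, ha]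
  simp

lemma aux_pw_sub {G : Type*} [Group G] {d : ℕ} {a : G} (ha : a ^ d = 1) (i : ZMod d) :
    a ^ ((i - 1).cast : ℤ) = a ^ (i.cast : ℤ) * a⁻¹ := by
  rw [aux_pw ha (i - 1) ((i.cast : ℤ) - 1) (by simp), zpow_sub_one]

lemma aux_tt {G : Type*} [Group G] {z s : G} (h : z * s * z * s = s * z * s * z) (x : ℤ) :
    ((z ^ x)⁻¹ * s * z ^ x) * ((z ^ x * z⁻¹)⁻¹ * s * (z ^ x * z⁻¹)) = s * z * s * z⁻¹ := by
  have hc : Commute z (s * z * s) := by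
    show z * (s * z * s) = s * z * s * z
    rw [← h]; group
  have h2 := (hc.zpow_left x).eq
  have h3 : z ^ x * z⁻¹ = z⁻¹ * z ^ x := ((Commute.refl z).zpow_left x).inv_right.eq
  calc _ = (z ^ x)⁻¹ * (s * z * s) * (z ^ x * z⁻¹) := by
          rw [h3]; group
    _ = (z ^ x)⁻¹ * (s * z * s * z ^ x) * z⁻¹ := by group
    _ = _ := by rw [← h2]; group

lemma rel1 {d n : ℕ} {a b : FreeGroup (Gen1 d n)} (h : Rels1 d n (a * b⁻¹)) :
    PresentedGroup.mk (setOf (Rels1 d n)) a = PresentedGroup.mk (setOf (Rels1 d n)) b :=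
  PresentedGroup.mk_eq_mk_of_mul_inv_mem h

lemma rel2 {d n : ℕ} {a b : FreeGroup (Gen2 n)} (h : Rels2 d n (a * b⁻¹)) :
    PresentedGroup.mk (setOf (Rels2 d n)) a = PresentedGroup.mk (setOf (Rels2 d n)) b :=
  PresentedGroup.mk_eq_mk_of_mul_inv_mem h

/-- The images of the generators of `Γ₁` in `Γ₂`. -/
def fwd (d n : ℕ) (hn : 2 ≤ n) : Gen1 d n → Gamma2 d n
  | .z => PresentedGroup.of Gen2.z
  | .t i => ((PresentedGroup.of Gen2.z : Gamma2 d n) ^ (i.cast : ℤ))⁻¹ *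
      PresentedGroup.of (Gen2.s 2 le_rfl hn) * (PresentedGroup.of Gen2.z : Gamma2 d n) ^ (i.cast : ℤ)
  | .s j h3 hj => PresentedGroup.of (Gen2.s j (by omega) hj)

/-- The images of the generators of `Γ₂` in `Γ₁`. -/
def bwd (d n : ℕ) : Gen2 n → Gamma1 d n
  | .z => PresentedGroup.of Gen1.z
  | .s j _ hj => if h : 3 ≤ j then PresentedGroup.of (Gen1.s j h hj)
      else PresentedGroup.of (Gen1.t 0)

lemma zord2 (d n : ℕ) : (PresentedGroup.of Gen2.z : Gamma2 d n) ^ d = 1 :=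
  PresentedGroup.one_of_mem (rels := setOf (Rels2 d n)) Rels2.zord

lemma aux_conj_comm {G : Type*} [Group G] {z s u : G} (x : ℤ) (h : z * u = u * z)
    (h' : s * u = u * s) :
    u * ((z ^ x)⁻¹ * s * z ^ x) = ((z ^ x)⁻¹ * s * z ^ x) * u := by
  have h1 : Commute (z ^ x) u := Commute.zpow_left h x
  have h2 : Commute s u := h'
  exact ((h1.inv_left.mul_left h2).mul_left h1).eq.symm

lemma aux_conj_braid {G : Type*} [Group G] {z s u : G} (x : ℤ) (h : z * u = u * z)
    (h' : s * u * s = u * s * u) :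
    ((z ^ x)⁻¹ * s * z ^ x) * u * ((z ^ x)⁻¹ * s * z ^ x) =
      u * ((z ^ x)⁻¹ * s * z ^ x) * u := by
  have h1 : Commute (z ^ x) u := Commute.zpow_left h x
  have h2 : u = (z ^ x)⁻¹ * u * z ^ x := by
    rw [mul_assoc, ← h1.eq]; group
  generalize z ^ x = y at *
  calc _ = (y⁻¹ * s * y) * (y⁻¹ * u * y) * (y⁻¹ * s * y) := by rw [← h2]
    _ = y⁻¹ * (s * u * s) * y := by group
    _ = (y⁻¹ * u * y) * (y⁻¹ * s * y) * (y⁻¹ * u * y) := by rw [h']; group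
    _ = _ := by rw [← h2]

lemma fwd_rel (d n : ℕ) (hn : 2 ≤ n) :
    ∀ r ∈ setOf (Rels1 d n), FreeGroup.lift (fwd d n hn) r = 1 := by
  intro r hr
  have hz := zord2 d n
  rcases hr with i | ⟨j, h3, hj⟩ | ⟨i, j⟩ | ⟨i, h⟩ | ⟨i, j, h3, h4, hj⟩ |
    ⟨i, h3, h3', hn', hi⟩ | ⟨i, j, h3i, hni, h3j, hnj, hij⟩ | _ | i | ⟨j, h3, hj⟩
  · simp only [_root_.map_mul, _root_.map_inv, FreeGroup.lift_apply_of, mul_inv_eq_one, fwd]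
    rw [aux_pw_sub hz i]
    generalize ((PresentedGroup.of Gen2.z : Gamma2 d n) ^ (i.cast : ℤ)) = y
    group
  · simp only [_root_.map_mul, _root_.map_inv, FreeGroup.lift_apply_of, mul_inv_eq_one, fwd]
    exact rel2 (Rels2.zs j _ h3 hj)
  · simp only [_root_.map_mul, _root_.map_inv, FreeGroup.lift_apply_of, mul_inv_eq_one, fwd]
    rw [aux_pw_sub hz i, aux_pw_sub hz j]
    have := rel2 (Rels2.zszs (d := d) hn)
    simp only [_root_.map_mul] at this
    exact (aux_tt this _).trans (aux_tt this _).symm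
  · simp only [_root_.map_mul, _root_.map_inv, FreeGroup.lift_apply_of, mul_inv_eq_one, fwd]
    exact aux_conj_braid _ (rel2 (Rels2.zs 3 _ le_rfl h))
      (rel2 (Rels2.braid 2 le_rfl _ hn h))
  · simp only [_root_.map_mul, _root_.map_inv, FreeGroup.lift_apply_of, mul_inv_eq_one, fwd]
    exact aux_conj_comm _ (rel2 (Rels2.zs j _ h3 hj))
      (rel2 (Rels2.comm 2 j le_rfl hn _ hj (by omega)))
  · simp only [_root_.map_mul, _root_.map_inv, FreeGroup.lift_apply_of, mul_inv_eq_one, fwd]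
    exact rel2 (Rels2.braid i _ _ hn' hi)
  · simp only [_root_.map_mul, _root_.map_inv, FreeGroup.lift_apply_of, mul_inv_eq_one, fwd]
    exact rel2 (Rels2.comm i j _ hni _ hnj hij)
  · simp only [_root_.map_pow, FreeGroup.lift_apply_of, fwd]
    exact hz
  · simp only [_root_.map_pow, FreeGroup.lift_apply_of, fwd]
    have h : (PresentedGroup.of (Gen2.s 2 le_rfl hn) : Gamma2 d n) ^ 2 = 1 :=
      PresentedGroup.one_of_mem (rels := setOf (Rels2 d n)) (Rels2.ssq 2 le_rfl hn)
    generalize ((PresentedGroup.of Gen2.z : Gamma2 d n) ^ (i.cast : ℤ)) = y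
    generalize (PresentedGroup.of (Gen2.s 2 le_rfl hn) : Gamma2 d n) = s at *
    calc _ = y⁻¹ * s ^ 2 * y := by rw [pow_two, pow_two]; group
      _ = 1 := by rw [h]; group
  · simp only [_root_.map_pow, FreeGroup.lift_apply_of, fwd]
    exact PresentedGroup.one_of_mem (rels := setOf (Rels2 d n)) (Rels2.ssq j _ hj)

lemma zt1 (d n : ℕ) (i : ZMod d) : (PresentedGroup.of Gen1.z : Gamma1 d n) *
    PresentedGroup.of (Gen1.t i) = PresentedGroup.of (Gen1.t (i - 1)) * PresentedGroup.of Gen1.z :=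
  rel1 (Rels1.zt i)

lemma bwd_rel (d n : ℕ) :
    ∀ r ∈ setOf (Rels2 d n), FreeGroup.lift (bwd d n) r = 1 := by
  intro r hr
  rcases hr with h | ⟨j, h2, h3, hj⟩ | ⟨i, h2, h2', hn', hi⟩ |
    ⟨i, j, h2i, hni, h2j, hnj, hij⟩ | _ | ⟨j, h2, hj⟩
  · simp only [_root_.map_mul, _root_.map_inv, FreeGroup.lift_apply_of, mul_inv_eq_one, bwd]
    rw [dif_neg (by omega)]
    have e1 := zt1 d n 0
    have e2 := zt1 d n (0 - 1)
    have e3 : (PresentedGroup.of (Gen1.t 0) : Gamma1 d n) * PresentedGroup.of (Gen1.t (0 - 1)) =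
      PresentedGroup.of (Gen1.t (0 - 1)) * PresentedGroup.of (Gen1.t (0 - 1 - 1)) :=
      rel1 (Rels1.tt 0 (0 - 1))
    generalize (PresentedGroup.of Gen1.z : Gamma1 d n) = z at *
    generalize (PresentedGroup.of (Gen1.t 0) : Gamma1 d n) = t0 at *
    generalize (PresentedGroup.of (Gen1.t (0 - 1)) : Gamma1 d n) = t1 at *
    generalize (PresentedGroup.of (Gen1.t (0 - 1 - 1)) : Gamma1 d n) = t2 at *
    calc z * t0 * z * t0 = t1 * z * (z * t0) := by rw [← e1]; group
      _ = t1 * (z * t1) * z := by rw [e1]; group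
      _ = (t1 * t2) * z * z := by rw [e2]; group
      _ = t0 * (t1 * z) * z := by rw [← e3]; group
      _ = _ := by rw [← e1]; group
  · simp only [_root_.map_mul, _root_.map_inv, FreeGroup.lift_apply_of, mul_inv_eq_one, bwd]
    rw [dif_pos h3]
    exact rel1 (Rels1.zs j h3 hj)
  · simp only [_root_.map_mul, _root_.map_inv, FreeGroup.lift_apply_of, mul_inv_eq_one, bwd]
    rw [dif_pos (show 3 ≤ i + 1 by omega)]
    by_cases h3 : 3 ≤ i
    · rw [dif_pos h3]
      exact rel1 (Rels1.braid i h3 _ hn' hi)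
    · rw [dif_neg h3]
      obtain rfl : i = 2 := by omega
      exact rel1 (Rels1.tst 0 hi)
  · simp only [_root_.map_mul, _root_.map_inv, FreeGroup.lift_apply_of, mul_inv_eq_one, bwd]
    by_cases h3i : 3 ≤ i <;> by_cases h3j : 3 ≤ j
    · rw [dif_pos h3i, dif_pos h3j]
      exact rel1 (Rels1.comm i j h3i hni h3j hnj hij)
    · rw [dif_pos h3i, dif_neg h3j]
      exact rel1 (Rels1.st 0 i h3i (by omega) hni)
    · rw [dif_neg h3i, dif_pos h3j]
      exact (rel1 (Rels1.st 0 j h3j (by omega) hnj)).symm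
    · omega
  · simp only [_root_.map_pow, FreeGroup.lift_apply_of, bwd]
    exact PresentedGroup.one_of_mem (rels := setOf (Rels1 d n)) Rels1.zord
  · simp only [_root_.map_pow, FreeGroup.lift_apply_of, bwd]
    by_cases h3 : 3 ≤ j
    · rw [dif_pos h3]
      exact PresentedGroup.one_of_mem (rels := setOf (Rels1 d n)) (Rels1.ssq j h3 hj)
    · rw [dif_neg h3]
      exact PresentedGroup.one_of_mem (rels := setOf (Rels1 d n)) (Rels1.tsq 0)

lemma conj_t (d n : ℕ) (k : ℕ) :
    ((PresentedGroup.of Gen1.z : Gamma1 d n) ^ k)⁻¹ * PresentedGroup.of (Gen1.t 0) *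
      (PresentedGroup.of Gen1.z : Gamma1 d n) ^ k = PresentedGroup.of (Gen1.t (k : ZMod d)) := by
  induction k with
  | zero => simp
  | succ k ih =>
    have h := zt1 d n ((k + 1 : ℕ) : ZMod d)
    rw [show ((k + 1 : ℕ) : ZMod d) - 1 = k by push_cast; ring, ← ih] at h
    rw [pow_succ]
    generalize (PresentedGroup.of (Gen1.t ((k + 1 : ℕ) : ZMod d)) : Gamma1 d n) = w at *
    generalize (PresentedGroup.of Gen1.z : Gamma1 d n) ^ k = y at *
    rw [eq_inv_mul_of_mul_eq h]
    group

/-- There is an isomorphism `Γ₁ ≅ Γ₂` with `z ↦ z`, `s_j ↦ s_j` for `3 ≤ j ≤ n`,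
and `t_k ↦ z^{-k} s₂ z^k` for `0 ≤ k ≤ d-1`. -/
theorem CLL_presentation_iso_classical (d n : ℕ) (hd : 1 < d) (hn : 2 ≤ n) :
    ∃ φ : Gamma1 d n ≃* Gamma2 d n,
      φ (PresentedGroup.of Gen1.z) = PresentedGroup.of Gen2.z ∧
      (∀ (j : ℕ) (h3 : 3 ≤ j) (hjn : j ≤ n),
        φ (PresentedGroup.of (Gen1.s j h3 hjn)) =
          PresentedGroup.of (Gen2.s j (by omega) hjn)) ∧
      (∀ k : ℕ, k < d →
        φ (PresentedGroup.of (Gen1.t (k : ZMod d))) =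
          (PresentedGroup.of Gen2.z : Gamma2 d n) ^ (-(k : ℤ)) *
            PresentedGroup.of (Gen2.s 2 le_rfl hn) *
            (PresentedGroup.of Gen2.z : Gamma2 d n) ^ (k : ℤ)) := by
  have hz := zord2 d n
  let F : Gamma1 d n →* Gamma2 d n := PresentedGroup.toGroup (fwd_rel d n hn)
  let B : Gamma2 d n →* Gamma1 d n := PresentedGroup.toGroup (bwd_rel d n)
  have hF : ∀ g, F (PresentedGroup.of g) = fwd d n hn g := fun g => PresentedGroup.toGroup.of _
  have hB : ∀ g, B (PresentedGroup.of g) = bwd d n g := fun g => PresentedGroup.toGroup.of _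
  have h1 : B.comp F = MonoidHom.id _ := by
    apply PresentedGroup.ext
    rintro (_ | i | ⟨j, h3, hj⟩)
    · simp [hF, hB, fwd, bwd]
    · have : NeZero d := ⟨by omega⟩
      obtain ⟨k, rfl⟩ := ZMod.natCast_zmod_surjective i
      simp only [MonoidHom.comp_apply, hF, fwd]
      rw [aux_pw hz (k : ZMod d) k (by simp), zpow_natCast]
      simp only [_root_.map_mul, _root_.map_inv, _root_.map_pow, hB, bwd]
      rw [dif_neg (by omega)]
      exact conj_t d n k
    · simp [hF, hB, fwd, bwd, h3]
  have h2 : F.comp B = MonoidHom.id _ := by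
    apply PresentedGroup.ext
    rintro (_ | ⟨j, h2, hj⟩)
    · simp [hF, hB, fwd, bwd]
    · by_cases h3 : 3 ≤ j
      · simp [hF, hB, fwd, bwd, h3]
      · obtain rfl : j = 2 := by omega
        simp only [MonoidHom.comp_apply, hB, bwd]
        rw [dif_neg h3, hF]
        simp [fwd]
  have hE : ∀ g, MonoidHom.toMulEquiv F B h1 h2 (PresentedGroup.of g) = fwd d n hn g := hF
  refine ⟨MonoidHom.toMulEquiv F B h1 h2, hE _, fun j h3 hjn => hE _, fun k _ => ?_⟩
  rw [hE]
  simp only [fwd]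
  rw [aux_pw hz (k : ZMod d) k (by simp), zpow_neg]
end
end

section
/- Let d ≥ 2 and n ≥ 2. The listed expressions defining Λ₁^G, …, Λₙ^G are pairwise distinct elements of G(d,1,n), the map sending (a₁, a₂, …, aₙ), with aᵢ ranging over the listed expressions of Λᵢ^G, to the product a₁ a₂ ⋯ aₙ is a bijection onto G(d,1,n), and for every w ∈ G(d,1,n) the word over X obtained by concatenating the defining words of the factors of its normal form is a geodesic: its number of letters equals ℓ(w). -/
noncomputable section

open Complex Matrix

/-- The complex reflection group `G(d,1,n)`: monomial matrices whose nonzero entries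
are `d`-th roots of unity. -/
def Gd1n (d n : ℕ) : Set (Matrix (Fin n) (Fin n) ℂ) :=
  {w | ∃ σ : Equiv.Perm (Fin n),
    (∀ i j, w i j ≠ 0 ↔ j = σ i) ∧ (∀ i, (w i (σ i)) ^ d = 1)}

/-- The generating set `X = {z, s₂, …, sₙ}` of `G(d,1,n)`. -/
def genX1 (d n : ℕ) : Set (Matrix (Fin n) (Fin n) ℂ) :=
  {zMat d n} ∪ {x | ∃ j, 2 ≤ j ∧ j ≤ n ∧ x = sMat n j}

/-- Index type enumerating the `i·d` listed expressions of `Λ_i^G` for `2 ≤ i ≤ n`: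
`1`; `s_i ⋯ s_{i'}` for `2 ≤ i' ≤ i`; `s_i ⋯ s₂ z^k` for `1 ≤ k ≤ d-1`;
`s_i ⋯ s₂ z^k s₂ ⋯ s_{i'}` for `1 ≤ k ≤ d-1`, `2 ≤ i' ≤ i`. -/
inductive LamIdx1 (d i : ℕ) : Type
  | one : LamIdx1 d i
  | sdesc (i' : ℕ) (h2 : 2 ≤ i') (hi : i' ≤ i) : LamIdx1 d i
  | sz (k : ℕ) (hk1 : 1 ≤ k) (hk : k < d) : LamIdx1 d i
  | szs (k : ℕ) (hk1 : 1 ≤ k) (hk : k < d) (i' : ℕ) (h2 : 2 ≤ i') (hi : i' ≤ i) : LamIdx1 d i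

/-- Evaluation of a listed expression of `Λ_i^G` in `G(d,1,n)`. -/
def lamEval1 (d n i : ℕ) : LamIdx1 d i → Matrix (Fin n) (Fin n) ℂ
  | .one => 1
  | .sdesc i' _ _ => sDescM n i i'
  | .sz k _ _ => sDescM n i 2 * zMat d n ^ k
  | .szs k _ _ i' _ _ => sDescM n i 2 * zMat d n ^ k * sAscM n 2 i'

/-- Index of a normal form: an exponent `0 ≤ k ≤ d-1` (for `Λ₁^G = {z^k}`) together
with one listed expression of `Λ_i^G` for each `2 ≤ i ≤ n`. -/
def NFIdx1 (d n : ℕ) : Type := Fin d × (∀ j : Fin (n - 1), LamIdx1 d (j.val + 2))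

/-- The product `a₁ a₂ ⋯ aₙ` associated with a normal form index. -/
def nfEval1 (d n : ℕ) (p : NFIdx1 d n) : Matrix (Fin n) (Fin n) ℂ :=
  zMat d n ^ (p.1 : ℕ) *
    ((List.finRange (n - 1)).map (fun j : Fin (n - 1) => lamEval1 d n (j.val + 2) (p.2 j))).prod

/-- The number of letters of the defining word of a listed expression of `Λ_i^G`. -/
def lamWordLen1 (d i : ℕ) : LamIdx1 d i → ℕ
  | .one => 0
  | .sdesc i' _ _ => i - i' + 1
  | .sz k _ _ => (i - 1) + k
  | .szs k _ _ i' _ _ => (i - 1) + k + (i' - 1)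

/-- The number of letters of the concatenated word of a normal form. -/
def nfWordLen1 (d n : ℕ) (p : NFIdx1 d n) : ℕ :=
  (p.1 : ℕ) + ∑ j : Fin (n - 1), lamWordLen1 d (j.val + 2) (p.2 j)

namespace NF

def M (n : ℕ) (f : ℕ → ℕ) (c : ℕ → ℂ) : Matrix (Fin n) (Fin n) ℂ :=
  Matrix.of fun a b => if (b : ℕ) = f a then c a else 0

def F (m j r : ℕ) : ℕ := if r = m then j else if j ≤ r ∧ r < m then r + 1 else r

def C (d m k r : ℕ) : ℂ := if r = m then zetaC d ^ k else 1

def A (d n m j k : ℕ) : Matrix (Fin n) (Fin n) ℂ := M n (F m j) (C d m k)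

def ln (m j k : ℕ) : ℕ := if k = 0 then m - j else m + k + j

theorem M_ext {n : ℕ} {f g : ℕ → ℕ} {c e : ℕ → ℂ} (h : ∀ r < n, f r = g r)
    (h' : ∀ r < n, c r = e r) : M n f c = M n g e := by
  ext a b
  simp [M, h a a.2, h' a a.2]

theorem M_mul {n : ℕ} {f g : ℕ → ℕ} {c e : ℕ → ℂ} (h : ∀ r < n, f r < n) :
    M n f c * M n g e = M n (fun r => g (f r)) (fun r => c r * e (f r)) := by
  ext a b
  rw [Matrix.mul_apply, Finset.sum_eq_single (⟨f a, h a a.2⟩ : Fin n)]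
  · simp [M]
  · intro x _ hx
    have : (x : ℕ) ≠ f a := fun hh => hx (Fin.ext hh)
    simp [M, this]
  · simp

theorem M_one {n : ℕ} : M n (fun r => r) (fun _ => 1) = 1 := by
  ext a b
  simp only [M, Matrix.of_apply, Matrix.one_apply, Fin.ext_iff]
  grind

theorem F_lt {n m j r : ℕ} (hm : m < n) (hj : j ≤ m) (hr : r < n) : F m j r < n := by
  unfold F; grind

theorem zeta_pow (d : ℕ) (hd : 2 ≤ d) : zetaC d ^ d = 1 :=
  (Complex.isPrimitiveRoot_exp d (by omega)).pow_eq_one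

theorem prim (d : ℕ) (hd : 2 ≤ d) : IsPrimitiveRoot (zetaC d) d :=
  Complex.isPrimitiveRoot_exp d (by omega)

theorem zeta_ne (d : ℕ) : zetaC d ≠ 0 := Complex.exp_ne_zero _

theorem A_mul {d n m j k m' j' k' : ℕ} (hm : m < n) (hj : j ≤ m) :
    A d n m j k * A d n m' j' k' =
      M n (fun r => F m' j' (F m j r)) (fun r => C d m k r * C d m' k' (F m j r)) :=
  M_mul (fun _ hr => F_lt hm hj hr)

theorem A_one {d n m : ℕ} : A d n m m 0 = 1 := by
  rw [← M_one]
  apply M_ext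
  · intro r _; unfold F; grind
  · intro r _; unfold C; simp

theorem sMat_eq {d n t : ℕ} (ht : t + 1 < n) : sMat n (t + 2) = A d n (t + 1) t 0 := by
  ext a b
  simp only [sMat, A, M, Matrix.of_apply, F, C, pow_zero, Fin.ext_iff]
  grind

theorem zMat_eq {d n : ℕ} : zMat d n = A d n 0 0 1 := by
  ext a b
  simp only [zMat, A, M, Matrix.of_apply, F, C, pow_one, Fin.ext_iff]
  grind

theorem zMat_pow {d n : ℕ} (hn : 0 < n) (k : ℕ) : zMat d n ^ k = A d n 0 0 k := by
  induction k with
  | zero => rw [A_one, pow_zero]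
  | succ k ih =>
    rw [pow_succ, ih, zMat_eq, A_mul hn le_rfl]
    apply M_ext
    · intro r _; unfold F; grind
    · intro r _; unfold F C; grind

theorem sDesc_eq {d n m j : ℕ} (hj : j ≤ m) (hm : m < n) :
    sDescM n (m + 1) (j + 2) = A d n m j 0 := by
  induction m, hj using Nat.le_induction with
  | base => rw [A_one]; simp [sDescM]
  | succ m hj ih =>
    have h1 : sDescM n (m + 1 + 1) (j + 2) = sMat n (m + 2) * sDescM n (m + 1) (j + 2) := by
      unfold sDescM
      have : m + 1 + 1 + 1 - (j + 2) = (m + 1 + 1 - (j + 2)) + 1 := by omega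
      rw [this, List.range'_concat]
      simp
      congr 2; omega
    rw [h1, ih (by omega), sMat_eq (d := d) hm, A_mul hm (by omega)]
    apply M_ext
    · intro r _; unfold F; grind
    · intro r _; unfold C; grind

def Gf (j r : ℕ) : ℕ := if r = 0 then j else if r ≤ j then r - 1 else r

theorem sAsc_eq {n j : ℕ} (hm : j < n) :
    sAscM n 2 (j + 1) = M n (Gf j) (fun _ => 1) := by
  induction j with
  | zero =>
    have : sAscM n 2 (0 + 1) = 1 := by simp [sAscM]
    rw [this, ← M_one]
    apply M_ext
    · intro r _; unfold Gf; grind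
    · simp
  | succ j ih =>
    have h1 : sAscM n 2 (j + 1 + 1) = sAscM n 2 (j + 1) * sMat n (j + 2) := by
      unfold sAscM
      have : j + 1 + 1 + 1 - 2 = (j + 1 + 1 - 2) + 1 := by omega
      rw [this, List.range'_concat]
      simp
      congr 2; omega
    rw [h1, ih (by omega), sMat_eq (d := 0) hm, A, M_mul]
    · apply M_ext
      · intro r _; unfold F Gf; grind
      · intro r _; unfold C; grind
    · intro r _; unfold Gf; grind

def toPair {d i : ℕ} : LamIdx1 d i → ℕ × ℕ
  | .one => (i - 1, 0)
  | .sdesc i' _ _ => (i' - 2, 0)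
  | .sz k _ _ => (0, k)
  | .szs k _ _ i' _ _ => (i' - 1, k)

theorem toPair_inj {d m : ℕ} : Function.Injective (toPair : LamIdx1 d (m + 1) → ℕ × ℕ) := by
  intro a b h
  cases a <;> cases b <;> simp only [toPair, Prod.mk.injEq] at h <;>
    first
    | rfl
    | (exfalso; omega)
    | (congr 1 <;> omega)

theorem toPair_lt {d m : ℕ} (hd : 2 ≤ d) (a : LamIdx1 d (m + 1)) :
    (toPair a).1 ≤ m ∧ (toPair a).2 < d := by
  cases a <;> simp only [toPair] <;> omega

theorem toPair_surj {d m j k : ℕ} (hj : j ≤ m) (hk : k < d) :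
    ∃ a : LamIdx1 d (m + 1), toPair a = (j, k) := by
  by_cases hk0 : k = 0
  · subst hk0
    by_cases h : j = m
    · exact ⟨.one, by simp [toPair, h]⟩
    · exact ⟨.sdesc (j + 2) (by omega) (by omega), by simp [toPair]⟩
  · by_cases h : j = 0
    · exact ⟨.sz k (by omega) hk, by simp [toPair, h]⟩
    · exact ⟨.szs k (by omega) hk (j + 1) (by omega) (by omega), by simp [toPair]⟩

theorem wordLen_eq {d m : ℕ} (a : LamIdx1 d (m + 1)) :
    lamWordLen1 d (m + 1) a = ln m (toPair a).1 (toPair a).2 := by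
  cases a <;> simp only [toPair, lamWordLen1, ln] <;> grind

theorem sz_eq {d n m k : ℕ} (hm : m < n) :
    sDescM n (m + 1) 2 * zMat d n ^ k = A d n m 0 k := by
  rw [zMat_pow (by omega), sDesc_eq (d := d) (j := 0) (by omega) hm, A_mul hm (by omega)]
  apply M_ext
  · intro r _; unfold F; grind
  · intro r _; unfold F C; grind

theorem lamEval_eq {d n m : ℕ} (hm : m < n) (a : LamIdx1 d (m + 1)) :
    lamEval1 d n (m + 1) a = A d n m (toPair a).1 (toPair a).2 := by
  cases a with
  | one => simp [lamEval1, toPair, A_one]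
  | sdesc i' h2 hi =>
    obtain ⟨j, rfl⟩ := Nat.exists_eq_add_of_le' h2
    simp only [lamEval1, toPair]
    rw [sDesc_eq (d := d) (by omega) hm]; simp
  | sz k h1 h => simp only [lamEval1, toPair]; exact sz_eq hm
  | szs k h1 h i' h2 hi =>
    obtain ⟨j, rfl⟩ := Nat.exists_eq_add_of_le' (show 1 ≤ i' by omega)
    simp only [lamEval1, toPair]
    rw [sz_eq hm, sAsc_eq (by omega), A, M_mul (fun r hr => F_lt hm (by omega) hr)]
    apply M_ext
    · intro r _; unfold F Gf; grind
    · intro r _; unfold C; grind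

/-- letters allowed at level m -/
def X (d n m : ℕ) (x : Matrix (Fin n) (Fin n) ℂ) : Prop :=
  (x = A d n 0 0 1 ∧ 0 < m) ∨ ∃ t, t + 1 < m ∧ x = A d n (t + 1) t 0

theorem X_iff {d n : ℕ} (hn : 2 ≤ n) (x) : x ∈ genX1 d n ↔ X d n n x := by
  constructor
  · rintro (h | ⟨j, h2, hj, rfl⟩)
    · left; exact ⟨by rw [← zMat_eq]; exact h, by omega⟩
    · obtain ⟨t, rfl⟩ := Nat.exists_eq_add_of_le' h2
      right; exact ⟨t, by omega, sMat_eq (by omega)⟩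
  · rintro (⟨rfl, -⟩ | ⟨t, ht, rfl⟩)
    · left; exact zMat_eq.symm
    · right; exact ⟨t + 2, by omega, by omega, (sMat_eq ht).symm⟩

theorem step {d n m j k : ℕ} (hd : 2 ≤ d) (hm : m < n) (hj : j ≤ m) (hk : k < d) {x}
    (hx : X d n (m + 1) x) :
    (∃ j' k', j' ≤ m ∧ k' < d ∧ A d n m j k * x = A d n m j' k' ∧
      ln m j' k' ≤ ln m j k + 1) ∨
    (∃ x', X d n m x' ∧ A d n m j k * x = x' * A d n m j k) := by
  have hz := zeta_pow d hd
  rcases hx with ⟨rfl, -⟩ | ⟨t, ht, rfl⟩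
  · by_cases h0 : j = 0
    · left
      subst h0
      by_cases hk' : k + 1 = d
      · refine ⟨0, 0, hj, by omega, ?_, by unfold ln; grind⟩
        rw [A_mul hm hj]
        have : zetaC d ^ k * zetaC d = 1 := by rw [← pow_succ, hk', hz]
        apply M_ext
        · intro r _; unfold F; grind
        · intro r _; unfold F C; grind
      · refine ⟨0, k + 1, hj, by omega, ?_, by unfold ln; grind⟩
        rw [A_mul hm hj]
        apply M_ext
        · intro r _; unfold F; grind
        · intro r _; unfold F C; grind
    · right
      refine ⟨_, Or.inl ⟨rfl, by omega⟩, ?_⟩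
      rw [A_mul hm hj, A_mul (by omega) le_rfl]
      apply M_ext
      · intro r _; unfold F; grind
      · intro r _; unfold F C; grind
  · by_cases h1 : j = t
    · left
      refine ⟨t + 1, k, by omega, hk, ?_, by unfold ln; grind⟩
      rw [A_mul hm hj]
      apply M_ext
      · intro r _; unfold F; grind
      · intro r _; unfold F C; grind
    by_cases h2 : j = t + 1
    · left
      refine ⟨t, k, by omega, hk, ?_, by unfold ln; grind⟩
      rw [A_mul hm hj]
      apply M_ext
      · intro r _; unfold F; grind
      · intro r _; unfold F C; grind
    right
    by_cases h3 : t + 1 < j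
    · refine ⟨_, Or.inr ⟨t, by omega, rfl⟩, ?_⟩
      rw [A_mul hm hj, A_mul (by omega) (by omega)]
      apply M_ext
      · intro r _; unfold F; grind
      · intro r _; unfold F C; grind
    · obtain ⟨u, rfl⟩ := Nat.exists_eq_add_of_le' (show 1 ≤ t by omega)
      refine ⟨_, Or.inr ⟨u, by omega, rfl⟩, ?_⟩
      rw [A_mul hm hj, A_mul (by omega) (by omega)]
      apply M_ext
      · intro r _; unfold F; grind
      · intro r _; unfold F C; grind

def P (d n : ℕ) (q : ℕ → ℕ × ℕ) (m : ℕ) : Matrix (Fin n) (Fin n) ℂ :=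
  ((List.range m).map fun r => A d n r (q r).1 (q r).2).prod

def L (q : ℕ → ℕ × ℕ) (m : ℕ) : ℕ := ∑ r ∈ Finset.range m, ln r (q r).1 (q r).2

def V (d : ℕ) (q : ℕ → ℕ × ℕ) (m : ℕ) : Prop := ∀ r < m, (q r).1 ≤ r ∧ (q r).2 < d

theorem P_succ (d n q m) : P d n q (m + 1) = P d n q m * A d n m (q m).1 (q m).2 := by
  simp [P, List.range_succ]

theorem L_succ (q m) : L q (m + 1) = L q m + ln m (q m).1 (q m).2 := by
  simp [L, Finset.sum_range_succ]

theorem P_congr {d n q q' m} (h : ∀ r < m, q r = q' r) : P d n q m = P d n q' m := by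
  unfold P
  congr 1
  apply List.map_congr_left
  intro r hr
  rw [h r (List.mem_range.1 hr)]

theorem L_congr {q q' : ℕ → ℕ × ℕ} {m} (h : ∀ r < m, q r = q' r) : L q m = L q' m := by
  unfold L
  apply Finset.sum_congr rfl
  intro r hr
  rw [h r (Finset.mem_range.1 hr)]

theorem trans {d n : ℕ} (hd : 2 ≤ d) (m : ℕ) (hm : m ≤ n) (q) (hq : V d q m) (x)
    (hx : X d n m x) : ∃ q', V d q' m ∧ P d n q m * x = P d n q' m ∧ L q' m ≤ L q m + 1 := by
  induction m generalizing q x with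
  | zero => rcases hx with ⟨_, h⟩ | ⟨t, h, _⟩ <;> omega
  | succ m ih =>
    obtain ⟨h1, h2⟩ := hq m (by omega)
    have hup : ∀ (q' : ℕ → ℕ × ℕ) (v : ℕ × ℕ), ∀ r < m, Function.update q' m v r = q' r := by
      intro q' v r hr
      exact Function.update_of_ne (by omega) _ _
    have hV : ∀ (q' : ℕ → ℕ × ℕ) (v : ℕ × ℕ), V d q' m → v.1 ≤ m → v.2 < d →
        V d (Function.update q' m v) (m + 1) := by
      intro q' v hv hv1 hv2 r hr
      by_cases h : r = m
      · subst h; simpa using ⟨hv1, hv2⟩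
      · rw [hup q' v r (by omega)]; exact hv r (by omega)
    rcases step hd (by omega) h1 h2 hx with ⟨j', k', hj', hk', he, hl⟩ | ⟨x', hx', he⟩
    · refine ⟨Function.update q m (j', k'), hV _ _ (fun r hr => hq r (by omega)) hj' hk', ?_, ?_⟩
      · rw [P_succ, P_succ, P_congr (hup q _), mul_assoc, he]; simp
      · rw [L_succ, L_succ, L_congr (hup q _)]; simp; omega
    · obtain ⟨q', hq', hP, hL⟩ := ih (by omega) q (fun r hr => hq r (by omega)) x' hx'
      refine ⟨Function.update q' m (q m), hV _ _ hq' h1 h2, ?_, ?_⟩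
      · rw [P_succ, P_succ, P_congr (hup q' _), mul_assoc, he, ← mul_assoc, hP]; simp
      · rw [L_succ, L_succ, L_congr (hup q' _)]; simp; omega

theorem A_id {d n : ℕ} (m : ℕ) : P d n (fun r => (r, 0)) m = 1 := by
  induction m with
  | zero => simp [P]
  | succ m ih => rw [P_succ, ih, A_one, one_mul]

theorem lower {d n : ℕ} (hd : 2 ≤ d) (l : List (Matrix (Fin n) (Fin n) ℂ))
    (hl : ∀ x ∈ l, X d n n x) :
    ∃ q, V d q n ∧ l.prod = P d n q n ∧ L q n ≤ l.length := by
  induction l using List.reverseRecOn with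
  | nil =>
    refine ⟨fun r => (r, 0), fun r _ => ⟨le_rfl, by simp; omega⟩, by simp [A_id], by simp [L, ln]⟩
  | append_singleton l x ih =>
    obtain ⟨q, hq, hP, hL⟩ := ih (fun y hy => hl y (by simp [hy]))
    obtain ⟨q', hq', hP', hL'⟩ := trans hd n le_rfl q hq x (hl x (by simp))
    exact ⟨q', hq', by simp [hP, hP'], by simp; omega⟩

/-- inverse -/
def Fi (m j r : ℕ) : ℕ := if r = j then m else if j < r ∧ r ≤ m then r - 1 else r
def Ci (d j k r : ℕ) : ℂ := if r = j then (zetaC d ^ k)⁻¹ else 1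
def B (d n m j k : ℕ) : Matrix (Fin n) (Fin n) ℂ := M n (Fi m j) (Ci d j k)

theorem AB {d n m j k : ℕ} (hm : m < n) (hj : j ≤ m) : A d n m j k * B d n m j k = 1 := by
  have hz : zetaC d ^ k ≠ 0 := pow_ne_zero _ (zeta_ne d)
  have hz' := mul_inv_cancel₀ hz
  rw [A, B, M_mul (fun _ hr => F_lt hm hj hr), ← M_one]
  apply M_ext
  · intro r _; unfold F Fi; grind
  · intro r _; unfold F C Ci; grind

theorem BA {d n m j k : ℕ} (hm : m < n) (hj : j ≤ m) : B d n m j k * A d n m j k = 1 :=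
  mul_eq_one_comm.1 (AB hm hj)

theorem P_row {d n : ℕ} (m : ℕ) (hm : m ≤ n) (q) (hq : V d q m) (a : Fin n) (ha : m ≤ a) (b) :
    P d n q m a b = (1 : Matrix (Fin n) (Fin n) ℂ) a b := by
  induction m generalizing b with
  | zero => simp [P]
  | succ m ih =>
    rw [P_succ, Matrix.mul_apply]
    simp_rw [ih (by omega) (fun r hr => hq r (by omega)) (by omega)]
    rw [← Matrix.mul_apply, one_mul]
    have := hq m (by omega)
    simp only [A, M, F, C, Matrix.of_apply, Matrix.one_apply, Fin.ext_iff]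
    grind

theorem P_row' {d n : ℕ} (m : ℕ) (hm : m < n) (q) (hq : V d q (m + 1)) (b) :
    P d n q (m + 1) ⟨m, hm⟩ b = if (b : ℕ) = (q m).1 then zetaC d ^ (q m).2 else 0 := by
  rw [P_succ, Matrix.mul_apply]
  simp_rw [P_row m hm.le q (fun r hr => hq r (by omega)) ⟨m, hm⟩ le_rfl]
  rw [← Matrix.mul_apply, one_mul]
  simp [A, M, F, C]

theorem row_inj {d n j k j' k' : ℕ} (hd : 2 ≤ d) (hj : j < n) (hk : k < d) (hk' : k' < d)
    (h : ∀ b : Fin n, (if (b : ℕ) = j then zetaC d ^ k else 0) =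
      (if (b : ℕ) = j' then zetaC d ^ k' else 0)) : (j, k) = (j', k') := by
  have h1 := h ⟨j, hj⟩
  have hz : zetaC d ^ k ≠ 0 := pow_ne_zero _ (zeta_ne d)
  simp only [if_true] at h1
  split_ifs at h1 with h2
  · rw [(prim d hd).pow_inj hk hk' h1, h2]
  · exact absurd h1 hz

theorem P_inj {d n : ℕ} (hd : 2 ≤ d) (m : ℕ) (hm : m ≤ n) (q q') (hq : V d q m) (hq' : V d q' m)
    (h : P d n q m = P d n q' m) : ∀ r < m, q r = q' r := by
  induction m with
  | zero => intro r hr; omega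
  | succ m ih =>
    obtain ⟨h1, h2⟩ := hq m (by omega)
    obtain ⟨h1', h2'⟩ := hq' m (by omega)
    have e : q m = q' m := by
      apply row_inj (n := n) hd (by omega) h2 h2'
      intro b
      rw [← P_row' m hm q hq, ← P_row' m hm q' hq', h]
    have e2 : P d n q m = P d n q' m := by
      rw [P_succ, P_succ, ← e] at h
      have := congrArg (· * B d n m (q m).1 (q m).2) h
      simpa [mul_assoc, AB (show m < n by omega) h1] using this
    have := ih (by omega) (fun r hr => hq r (by omega)) (fun r hr => hq' r (by omega)) e2
    intro r hr
    by_cases hrm : r = m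
    · rw [hrm, e]
    · exact this r (by omega)

theorem P_surj {d n : ℕ} (hd : 2 ≤ d) (m : ℕ) (hm : m ≤ n) (f : ℕ → ℕ) (c : ℕ → ℂ)
    (hf : ∀ r < n, f r < n) (hi : ∀ r < n, ∀ s < n, f r = f s → r = s)
    (hc : ∀ r < n, c r ^ d = 1) (hfm : ∀ r < n, m ≤ r → f r = r ∧ c r = 1) :
    ∃ q, V d q m ∧ M n f c = P d n q m := by
  induction m generalizing f c with
  | zero =>
    refine ⟨fun r => (r, 0), fun r hr => by omega, ?_⟩
    rw [A_id, ← M_one]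
    exact M_ext (fun r hr => (hfm r hr (by omega)).1) (fun r hr => (hfm r hr (by omega)).2)
  | succ m ih =>
    haveI : NeZero d := ⟨by omega⟩
    obtain ⟨k, hk, hck⟩ := (prim d hd).eq_pow_of_pow_eq_one (hc m hm)
    have hj : f m ≤ m := by
      by_contra hlt
      have := (hfm (f m) (hf m hm) (by omega)).1
      have := hi _ (hf m hm) m hm this
      omega
    have hz : zetaC d ^ k ≠ 0 := pow_ne_zero _ (zeta_ne d)
    have hzd : (zetaC d ^ k) ^ d = 1 := by rw [hck]; exact hc m hm
    obtain ⟨q, hq, hP⟩ := ih (by omega) (fun r => Fi m (f m) (f r))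
      (fun r => c r * Ci d (f m) k (f r)) (by
        intro r hr
        have := hf r hr
        unfold Fi; grind) (by
        intro r hr s hs hrs
        apply hi r hr s hs
        unfold Fi at hrs; grind) (by
        intro r hr
        rw [mul_pow, hc r hr, one_mul]
        unfold Ci
        split_ifs
        · rw [inv_pow, hzd, inv_one]
        · simp) (by
        intro r hr hmr
        by_cases h : r = m
        · subst h
          simp only [Fi, Ci, if_true, true_and]
          rw [hck]
          exact mul_inv_cancel₀ (hck ▸ hz)
        · obtain ⟨e1, e2⟩ := hfm r hr (by omega)
          rw [e1, e2]
          unfold Fi Ci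
          grind)
    have hne : ∀ r < m, Function.update q m (f m, k) r = q r :=
      fun r hr => Function.update_of_ne (by omega) _ _
    refine ⟨Function.update q m (f m, k), ?_, ?_⟩
    · intro r hr
      by_cases h : r = m
      · subst h; simpa using ⟨hj, hk⟩
      · rw [hne r (by omega)]; exact hq r (by omega)
    · rw [P_succ, P_congr hne, ← hP, ← M_mul hf, ← B, mul_assoc]
      simp [BA (show m < n by omega) hj]

theorem M_mem {d n : ℕ} (hd : 2 ≤ d) (f : ℕ → ℕ) (c : ℕ → ℂ)
    (hf : ∀ r < n, f r < n) (hi : ∀ r < n, ∀ s < n, f r = f s → r = s)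
    (hc : ∀ r < n, c r ^ d = 1) : M n f c ∈ Gd1n d n := by
  let g : Fin n → Fin n := fun a => ⟨f a, hf a a.2⟩
  have hg : Function.Injective g := fun a b h =>
    Fin.ext (hi a a.2 b b.2 (congrArg Fin.val h))
  have hc0 : ∀ r < n, c r ≠ 0 := by
    intro r hr h0
    have := hc r hr
    rw [h0, zero_pow (by omega)] at this
    exact zero_ne_one this
  refine ⟨Equiv.ofBijective g (Finite.injective_iff_bijective.1 hg), ?_, ?_⟩
  · intro a b
    simp [M, g, Fin.ext_iff, hc0 a a.2]
  · intro a
    simpa [M, g] using hc a a.2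

theorem P_form {d n : ℕ} (hd : 2 ≤ d) (m : ℕ) (hm : m ≤ n) (q) (hq : V d q m) :
    ∃ f c, (∀ r < n, f r < n) ∧ (∀ r < n, ∀ s < n, f r = f s → r = s) ∧
      (∀ r < n, c r ^ d = 1) ∧ P d n q m = M n f c := by
  induction m with
  | zero =>
    exact ⟨fun r => r, fun _ => 1, fun r h => h, fun r _ s _ h => h, by simp, by simp [P, M_one]⟩
  | succ m ih =>
    obtain ⟨f, c, hf, hi, hc, hP⟩ := ih (by omega) (fun r hr => hq r (by omega))
    obtain ⟨h1, h2⟩ := hq m (by omega)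
    refine ⟨fun r => F m (q m).1 (f r), fun r => c r * C d m (q m).2 (f r), ?_, ?_, ?_, ?_⟩
    rotate_left 3
    · rw [P_succ, hP, A, M_mul hf]
    · intro r hr
      exact F_lt (by omega) h1 (hf r hr)
    · intro r hr s hs h
      apply hi r hr s hs
      unfold F at h; grind
    · intro r hr
      simp only [mul_pow, hc r hr, one_mul, C]
      split_ifs
      · rw [← pow_mul, mul_comm, pow_mul, zeta_pow d hd, one_pow]
      · simp

theorem Gd1n_form {d n : ℕ} (w) (hw : w ∈ Gd1n d n) :
    ∃ f c, (∀ r < n, f r < n) ∧ (∀ r < n, ∀ s < n, f r = f s → r = s) ∧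
      (∀ r < n, c r ^ d = 1) ∧ w = M n f c := by
  obtain ⟨σ, h1, h2⟩ := hw
  refine ⟨fun r => if h : r < n then σ ⟨r, h⟩ else 0,
    fun r => if h : r < n then w ⟨r, h⟩ (σ ⟨r, h⟩) else 0, ?_, ?_, ?_, ?_⟩
  · intro r hr; simp [hr]
  · intro r hr s hs h
    simp only [hr, hs, dif_pos] at h
    simpa using σ.injective (Fin.ext h)
  · intro r hr; simp [hr, h2]
  · ext a b
    simp only [M, Matrix.of_apply, a.2, dif_pos, ← Fin.ext_iff]
    split_ifs with h
    · rw [h]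
    · by_contra h0
      exact h ((h1 a b).1 h0)

/-- sequence attached to a normal form index -/
def toSeq {d n : ℕ} (p : NFIdx1 d n) : ℕ → ℕ × ℕ
  | 0 => (0, p.1)
  | r + 1 => if h : r < n - 1 then toPair (p.2 ⟨r, h⟩) else (0, 0)

theorem toSeq_V {d n : ℕ} (hd : 2 ≤ d) (p : NFIdx1 d n) : V d (toSeq p) n := by
  intro r hr
  cases r with
  | zero => simp [toSeq]
  | succ r =>
    have h : r < n - 1 := by omega
    simp only [toSeq, h, dif_pos]
    exact toPair_lt hd _

theorem nfEval_eq {d n : ℕ} (hn : 2 ≤ n) (p : NFIdx1 d n) :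
    nfEval1 d n p = P d n (toSeq p) n := by
  obtain ⟨m, rfl⟩ := Nat.exists_eq_add_of_le' (show 1 ≤ n by omega)
  unfold nfEval1 P
  rw [List.range_succ_eq_map, List.map_cons, List.prod_cons, zMat_pow (by omega)]
  simp only [toSeq]
  congr 2
  rw [List.map_map, ← List.map_coe_finRange_eq_range, List.map_map]
  apply List.map_congr_left
  intro j _
  rw [lamEval_eq (by have := j.2; omega)]
  have : (j : ℕ) < m + 1 - 1 := j.2
  simp [toSeq]

theorem nfLen_eq {d n : ℕ} (hn : 2 ≤ n) (p : NFIdx1 d n) :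
    nfWordLen1 d n p = L (toSeq p) n := by
  obtain ⟨m, rfl⟩ := Nat.exists_eq_add_of_le' (show 1 ≤ n by omega)
  unfold nfWordLen1 L
  rw [Finset.sum_range_succ', add_comm]
  congr 1
  · rw [← Fin.sum_univ_eq_sum_range (fun r => ln (r + 1) (toSeq p (r + 1)).1 (toSeq p (r + 1)).2)]
    apply Finset.sum_congr rfl
    intro j _
    rw [wordLen_eq]
    have : (j : ℕ) < m + 1 - 1 := j.2
    simp [toSeq]
  · simp only [toSeq, ln]; grind

theorem toSeq_inj {d n : ℕ} (hn : 2 ≤ n) (p p' : NFIdx1 d n)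
    (h : ∀ r < n, toSeq p r = toSeq p' r) : p = p' := by
  apply Prod.ext
  · have := h 0 (by omega)
    simp only [toSeq, Prod.mk.injEq, true_and] at this
    exact Fin.ext this
  · funext j
    have := h (j + 1) (by have := j.2; omega)
    simp only [toSeq, j.2, dif_pos] at this
    exact toPair_inj this

theorem toSeq_surj {d n : ℕ} (hn : 2 ≤ n) (q) (hq : V d q n) :
    ∃ p : NFIdx1 d n, ∀ r < n, toSeq p r = q r := by
  have h : ∀ j : Fin (n - 1), ∃ a : LamIdx1 d (j.val + 2), toPair a = q (j + 1) := by
    intro j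
    have := hq (j + 1) (by have := j.2; omega)
    exact toPair_surj this.1 this.2
  choose g hg using h
  have h0 := hq 0 (by omega)
  refine ⟨(⟨(q 0).2, h0.2⟩, g), ?_⟩
  intro r hr
  cases r with
  | zero => simp only [toSeq]; exact Prod.ext (by simp at h0; simp [h0.1]) rfl
  | succ r =>
    have h : r < n - 1 := by omega
    simp only [toSeq, h, dif_pos]
    exact hg _

theorem word_s {d n : ℕ} (hn : 2 ≤ n) (l : List ℕ) (hl : ∀ j ∈ l, 2 ≤ j ∧ j ≤ n) :
    ∀ x ∈ l.map (sMat n), x ∈ genX1 d n := by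
  intro x hx
  obtain ⟨j, hj, rfl⟩ := List.mem_map.1 hx
  exact Or.inr ⟨j, (hl j hj).1, (hl j hj).2, rfl⟩

theorem lam_word {d n m : ℕ} (hm : m < n) (a : LamIdx1 d (m + 1)) :
    ∃ l : List (Matrix (Fin n) (Fin n) ℂ), (∀ x ∈ l, x ∈ genX1 d n) ∧
      l.length = lamWordLen1 d (m + 1) a ∧ l.prod = lamEval1 d n (m + 1) a := by
  have hdesc : ∀ i', 2 ≤ i' → ∀ x ∈ ((List.range' i' (m + 1 + 1 - i')).reverse).map (sMat n),
      x ∈ genX1 d n := by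
    intro i' hi' x hx
    obtain ⟨j, hj, rfl⟩ := List.mem_map.1 hx
    simp at hj
    exact Or.inr ⟨j, by omega, by omega, rfl⟩
  have hz : ∀ k, ∀ x ∈ List.replicate k (zMat d n), x ∈ genX1 d n := by
    intro k x hx
    exact Or.inl (List.eq_of_mem_replicate hx)
  cases a with
  | one => exact ⟨[], by simp, rfl, rfl⟩
  | sdesc i' h2 hi =>
    refine ⟨_, hdesc i' h2, ?_, rfl⟩
    simp [lamWordLen1]; omega
  | sz k h1 h =>
    refine ⟨((List.range' 2 (m + 1 + 1 - 2)).reverse).map (sMat n) ++ List.replicate k (zMat d n), ?_, ?_, ?_⟩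
    rotate_left 2
    · rw [List.prod_append, List.prod_replicate]; rfl
    · intro x hx
      rcases List.mem_append.1 hx with hx | hx
      · exact hdesc 2 le_rfl x hx
      · exact hz k x hx
    · simp [lamWordLen1]
  | szs k h1 h i' h2 hi =>
    refine ⟨((List.range' 2 (m + 1 + 1 - 2)).reverse).map (sMat n) ++ List.replicate k (zMat d n) ++ (List.range' 2 (i' + 1 - 2)).map (sMat n), ?_, ?_, ?_⟩
    rotate_left 2
    · rw [List.prod_append, List.prod_append, List.prod_replicate]; rfl
    · intro x hx
      rcases List.mem_append.1 hx with hx | hx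
      · rcases List.mem_append.1 hx with hx | hx
        · exact hdesc 2 le_rfl x hx
        · exact hz k x hx
      · obtain ⟨j, hj, rfl⟩ := List.mem_map.1 hx
        simp at hj
        exact Or.inr ⟨j, by omega, by omega, rfl⟩
    · simp [lamWordLen1]; omega

theorem P_word {d n : ℕ} (hd : 2 ≤ d) (m : ℕ) (hm : m ≤ n) (q) (hq : V d q m) :
    ∃ l : List (Matrix (Fin n) (Fin n) ℂ), (∀ x ∈ l, x ∈ genX1 d n) ∧
      l.length = L q m ∧ l.prod = P d n q m := by
  induction m with
  | zero => exact ⟨[], by simp, by simp [L], by simp [P]⟩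
  | succ m ih =>
    obtain ⟨l, hl, hlen, hprod⟩ := ih (by omega) (fun r hr => hq r (by omega))
    have h := hq m (by omega)
    obtain ⟨a, ha⟩ : ∃ l : List (Matrix (Fin n) (Fin n) ℂ), (∀ x ∈ l, x ∈ genX1 d n) ∧
        l.length = ln m (q m).1 (q m).2 ∧ l.prod = A d n m (q m).1 (q m).2 := by
      obtain ⟨a, ha⟩ := toPair_surj h.1 h.2
      obtain ⟨l, h1, h2, h3⟩ := lam_word (n := n) (by omega) a
      refine ⟨l, h1, ?_, ?_⟩
      · rw [h2, wordLen_eq, ha]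
      · rw [h3, lamEval_eq (by omega), ha]
    refine ⟨l ++ a, ?_, ?_, ?_⟩
    · intro x hx
      rcases List.mem_append.1 hx with hx | hx
      · exact hl x hx
      · exact ha.1 x hx
    · rw [List.length_append, hlen, ha.2.1, L_succ]
    · rw [List.prod_append, hprod, ha.2.2, P_succ]

theorem A_inj {d n m : ℕ} (hd : 2 ≤ d) (hm : m < n) {j k j' k' : ℕ} (hj : j ≤ m)
    (hk : k < d) (hk' : k' < d) (h : A d n m j k = A d n m j' k') : (j, k) = (j', k') := by
  apply row_inj (n := n) hd (by omega) hk hk'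
  intro b
  have := congrFun (congrFun h ⟨m, hm⟩) b
  simpa [A, M, F, C] using this

end NF

/-- The listed expressions of `Λ₁^G, …, Λₙ^G` are pairwise distinct elements of
`G(d,1,n)`, the product map is a bijection onto `G(d,1,n)`, and the concatenated
word of each normal form is geodesic. -/
theorem normal_forms_for_Gd1n (d n : ℕ) (hd : 2 ≤ d) (hn : 2 ≤ n) :
    Function.Injective (fun k : Fin d => zMat d n ^ (k : ℕ)) ∧
    (∀ i : ℕ, 2 ≤ i → i ≤ n → Function.Injective (lamEval1 d n i)) ∧
    Function.Injective (nfEval1 d n) ∧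
    Set.range (nfEval1 d n) = Gd1n d n ∧
    (∀ p : NFIdx1 d n, len (genX1 d n) (nfEval1 d n p) = nfWordLen1 d n p) := by
  refine ⟨?_, ?_, ?_, ?_, ?_⟩
  · intro k k' h
    simp only [NF.zMat_pow (show 0 < n by omega)] at h
    have := NF.A_inj hd (by omega) le_rfl k.2 k'.2 h
    exact Fin.ext (congrArg Prod.snd this)
  · intro i hi hin a b h
    obtain ⟨m, rfl⟩ := Nat.exists_eq_add_of_le' (show 1 ≤ i by omega)
    rw [NF.lamEval_eq hin, NF.lamEval_eq hin] at h
    have ha := NF.toPair_lt hd a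
    have hb := NF.toPair_lt hd b
    exact NF.toPair_inj (NF.A_inj hd hin ha.1 ha.2 hb.2 h)
  · intro p p' h
    rw [NF.nfEval_eq hn, NF.nfEval_eq hn] at h
    exact NF.toSeq_inj hn p p'
      (NF.P_inj hd n le_rfl _ _ (NF.toSeq_V hd p) (NF.toSeq_V hd p') h)
  · ext w
    constructor
    · rintro ⟨p, rfl⟩
      rw [NF.nfEval_eq hn]
      obtain ⟨f, c, hf, hi, hc, e⟩ := NF.P_form hd n le_rfl _ (NF.toSeq_V hd p)
      rw [e]
      exact NF.M_mem hd f c hf hi hc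
    · intro hw
      obtain ⟨f, c, hf, hi, hc, e⟩ := NF.Gd1n_form w hw
      obtain ⟨q, hq, hP⟩ := NF.P_surj hd n le_rfl f c hf hi hc (fun r hr h => by omega)
      obtain ⟨p, hp⟩ := NF.toSeq_surj hn q hq
      exact ⟨p, by rw [NF.nfEval_eq hn, e, hP, NF.P_congr hp]⟩
  · intro p
    have hV := NF.toSeq_V hd p
    apply le_antisymm
    · apply Nat.sInf_le
      rw [NF.nfEval_eq hn, NF.nfLen_eq hn]
      exact NF.P_word hd n le_rfl _ hV
    · apply le_csInf
      · rw [NF.nfEval_eq hn]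
        exact ⟨_, NF.P_word hd n le_rfl _ hV⟩
      · rintro k ⟨l, hl, rfl, hprod⟩
        obtain ⟨q, hq, hP, hL⟩ := NF.lower hd l (fun x hx => (NF.X_iff hn x).1 (hl x hx))
        rw [NF.nfEval_eq hn, hP] at hprod
        rw [NF.nfLen_eq hn, ← NF.L_congr (NF.P_inj hd n le_rfl _ _ hq hV hprod)]
        exact hL
end
end

section
/- Let d ≥ 2 and n ≥ 2. The scalar matrix ζ_d^{d−1}·Iₙ is the unique element of G(d,1,n) of maximal length ℓ over X, and its length equals n(n + d − 2). -/
noncomputable section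

open Complex Matrix

/-- Monomial matrix with permutation `σ` and exponents `a`. -/
def monoM (d n : ℕ) (σ : Equiv.Perm (Fin n)) (a : Fin n → ℕ) : Matrix (Fin n) (Fin n) ℂ :=
  Matrix.of fun i j => if j = σ i then zetaC d ^ a i else 0

/-- Contribution of a pair of rows. -/
def pairW {n : ℕ} (σ : Equiv.Perm (Fin n)) (a : Fin n → ℕ) (x : Fin n × Fin n) : ℕ :=
  if σ x.2 < σ x.1 then 1 else if a x.2 = 0 then 0 else 2

/-- Index set of pairs. -/
def pairsF (n : ℕ) : Finset (Fin n × Fin n) := Finset.univ.filter fun x => x.1 < x.2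

/-- The explicit length function. -/
def lenF {n : ℕ} (σ : Equiv.Perm (Fin n)) (a : Fin n → ℕ) : ℕ :=
  ∑ i, a i + ∑ x ∈ pairsF n, pairW σ a x

theorem mem_pairsF {n : ℕ} (x : Fin n × Fin n) : x ∈ pairsF n ↔ x.1 < x.2 := by
  simp [pairsF]

theorem zeta_prim {d : ℕ} (hd : 2 ≤ d) : IsPrimitiveRoot (zetaC d) d :=
  Complex.isPrimitiveRoot_exp d (by omega)

theorem monoM_mul_s (d n : ℕ) (σ : Equiv.Perm (Fin n)) (a : Fin n → ℕ) (p : ℕ) (hp : p + 1 < n) :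
    monoM d n σ a * sMat n (p + 2) =
      monoM d n (Equiv.swap ⟨p, by omega⟩ ⟨p + 1, hp⟩ * σ) a := by
  ext i j
  rw [Matrix.mul_apply, Finset.sum_eq_single (σ i)]
  · simp only [monoM, sMat, Matrix.of_apply, Equiv.Perm.mul_apply, Equiv.swap_apply_def, Fin.ext_iff]
    simp only [if_true]
    generalize (σ i) = k
    have e1 : p + 2 - 2 = p := by omega
    have e2 : p + 2 - 1 = p + 1 := by omega
    rw [e1, e2]
    by_cases hk1 : (k : ℕ) = p
    · by_cases hj : (j : ℕ) = p + 1 <;> simp [hk1, hj]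
    · by_cases hk2 : (k : ℕ) = p + 1
      · by_cases hj : (j : ℕ) = p <;> simp [hk2, hj]
      · by_cases hj : (j : ℕ) = k
        · simp [hk1, hk2, hj]
        · simp [hk1, hk2, hj, Ne.symm hj]
  · intro b _ hb
    simp [monoM, hb]
  · simp

theorem monoM_mul_z {d : ℕ} (hd : 2 ≤ d) (n : ℕ) (σ : Equiv.Perm (Fin n)) (a a' : Fin n → ℕ) (i0 : Fin n)
    (h0 : (σ i0 : ℕ) = 0) (h1 : ∀ i, i ≠ i0 → a' i = a i)
    (h2 : zetaC d ^ a' i0 = zetaC d ^ (a i0 + 1)) :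
    monoM d n σ a * zMat d n = monoM d n σ a' := by
  ext i j
  rw [Matrix.mul_apply, Finset.sum_eq_single (σ i)]
  · simp only [monoM, zMat, Matrix.of_apply, if_true]
    by_cases hi : i = i0
    · subst hi
      rw [h2, pow_succ]
      by_cases hj : j = σ i
      · simp [hj, h0]
      · simp [hj, Ne.symm hj]
    · have : ¬ ((σ i : ℕ) = 0) := by
        intro h
        exact hi (σ.injective (Fin.ext (h.trans h0.symm)))
      rw [h1 i hi]
      by_cases hj : j = σ i
      · simp [hj, this]
      · simp [hj, Ne.symm hj]
  · intro b _ hb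
    simp [monoM, hb]
  · simp

theorem lenF_z {n : ℕ} (σ : Equiv.Perm (Fin n)) (a a' : Fin n → ℕ) (i0 : Fin n)
    (h0 : (σ i0 : ℕ) = 0) (h1 : ∀ i, i ≠ i0 → a' i = a i) :
    lenF σ a' + a i0 = lenF σ a + a' i0 := by
  have e1 : ∑ x ∈ pairsF n, pairW σ a' x = ∑ x ∈ pairsF n, pairW σ a x := by
    apply Finset.sum_congr rfl
    rintro ⟨i, j⟩ hx
    rw [mem_pairsF] at hx
    simp only at hx
    unfold pairW
    by_cases hj : j = i0
    · subst hj
      have : σ j < σ i := by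
        rw [Fin.lt_def, h0]
        have : σ i ≠ σ j := fun h => hx.ne (σ.injective h)
        have : (σ i : ℕ) ≠ σ j := fun h => this (Fin.ext h)
        omega
      simp [this]
    · simp [h1 j hj]
  have e2 : ∑ i, a' i + a i0 = ∑ i, a i + a' i0 := by
    rw [← Finset.add_sum_erase _ a (Finset.mem_univ i0),
      ← Finset.add_sum_erase _ a' (Finset.mem_univ i0)]
    have := Finset.sum_congr rfl (fun i (hi : i ∈ Finset.univ.erase i0) =>
      h1 i (Finset.ne_of_mem_erase hi))
    linarith
  unfold lenF
  omega

theorem lenF_s {n : ℕ} (σ : Equiv.Perm (Fin n)) (a : Fin n → ℕ) (p q : Fin n)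
    (hpq : (q : ℕ) = p + 1) (x : Fin n × Fin n) (hx : x.1 < x.2)
    (hs : (σ x.1 = p ∧ σ x.2 = q) ∨ (σ x.1 = q ∧ σ x.2 = p)) :
    lenF (Equiv.swap p q * σ) a + pairW σ a x = lenF σ a + pairW (Equiv.swap p q * σ) a x := by
  have hm : x ∈ pairsF n := (mem_pairsF x).2 hx
  unfold lenF
  rw [← Finset.add_sum_erase _ (pairW σ a) hm,
    ← Finset.add_sum_erase _ (pairW (Equiv.swap p q * σ) a) hm]
  have : ∑ y ∈ (pairsF n).erase x, pairW (Equiv.swap p q * σ) a y =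
      ∑ y ∈ (pairsF n).erase x, pairW σ a y := by
    apply Finset.sum_congr rfl
    rintro ⟨i, j⟩ hy
    obtain ⟨hne, hy0⟩ := Finset.mem_erase.1 hy
    replace hy : i < j := (mem_pairsF _).1 hy0
    obtain ⟨u, v⟩ := x
    simp only at hs hx
    have key : (Equiv.swap p q * σ) j < (Equiv.swap p q * σ) i ↔ σ j < σ i := by
      have hij : σ i ≠ σ j := fun h => hy.ne (σ.injective h)
      have hno : ¬ (σ i = p ∧ σ j = q) := by
        rintro ⟨h1, h2⟩
        rcases hs with ⟨h3, h4⟩ | ⟨h3, h4⟩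
        · exact hne (Prod.ext (σ.injective (h1.trans h3.symm)) (σ.injective (h2.trans h4.symm)))
        · have e1 := σ.injective (h1.trans h4.symm)
          have e2 := σ.injective (h2.trans h3.symm)
          subst e1 e2
          exact absurd hx (not_lt.2 hy.le)
      have hno' : ¬ (σ i = q ∧ σ j = p) := by
        rintro ⟨h1, h2⟩
        rcases hs with ⟨h3, h4⟩ | ⟨h3, h4⟩
        · have e1 := σ.injective (h1.trans h4.symm)
          have e2 := σ.injective (h2.trans h3.symm)
          subst e1 e2
          exact absurd hx (not_lt.2 hy.le)
        · exact hne (Prod.ext (σ.injective (h1.trans h3.symm)) (σ.injective (h2.trans h4.symm)))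
      simp only [Equiv.Perm.mul_apply, Equiv.swap_apply_def]
      generalize σ i = I at *
      generalize σ j = J at *
      simp only [Fin.ext_iff, ne_eq] at hij hno hno' 
      simp only [Fin.ext_iff, Fin.lt_def]
      split_ifs <;> omega
    unfold pairW
    simp only [key]
  omega

theorem pairW_le {n : ℕ} (σ : Equiv.Perm (Fin n)) (a : Fin n → ℕ) (x : Fin n × Fin n) :
    pairW σ a x ≤ 2 := by
  unfold pairW; split_ifs <;> omega

theorem pairW_swap {n : ℕ} (σ : Equiv.Perm (Fin n)) (a : Fin n → ℕ) (p q : Fin n)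
    (hpq : (q : ℕ) = p + 1) (x : Fin n × Fin n) 
    (hs : (σ x.1 = p ∧ σ x.2 = q) ∨ (σ x.1 = q ∧ σ x.2 = p)) :
    (σ x.1 = p ∧ pairW σ a x = (if a x.2 = 0 then 0 else 2) ∧ pairW (Equiv.swap p q * σ) a x = 1) ∨
    (σ x.1 = q ∧ pairW σ a x = 1 ∧ pairW (Equiv.swap p q * σ) a x = (if a x.2 = 0 then 0 else 2)) := by
  have h1 : p < q := by rw [Fin.lt_def]; omega
  have h2 : ¬ q < p := not_lt.2 h1.le
  rcases hs with ⟨h3, h4⟩ | ⟨h3, h4⟩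
  · left
    simp [pairW, h3, h4, h1, h2]
  · right
    simp [pairW, h3, h4, h1, h2]

theorem exists_pair {n : ℕ} (σ : Equiv.Perm (Fin n)) (p q : Fin n)
    (hpq : (q : ℕ) = p + 1) : ∃ x : Fin n × Fin n, x.1 < x.2 ∧
    ((σ x.1 = p ∧ σ x.2 = q) ∨ (σ x.1 = q ∧ σ x.2 = p)) := by
  rcases lt_trichotomy (σ.symm p) (σ.symm q) with h | h | h
  · exact ⟨(σ.symm p, σ.symm q), h, by simp⟩
  · have := σ.symm.injective h
    rw [this] at hpq; omega
  · exact ⟨(σ.symm q, σ.symm p), h, by simp⟩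

theorem word_lower {d n : ℕ} (hd : 2 ≤ d) (hn : 2 ≤ n) (l : List (Matrix (Fin n) (Fin n) ℂ))
    (hl : ∀ x ∈ l, x ∈ genX1 d n) :
    ∃ σ : Equiv.Perm (Fin n), ∃ a : Fin n → ℕ, (∀ i, a i < d) ∧ l.prod = monoM d n σ a ∧
      lenF σ a ≤ l.length := by
  induction l using List.reverseRecOn with
  | nil =>
    refine ⟨1, fun _ => 0, fun _ => by simp only; omega, ?_, ?_⟩
    · ext i j
      simp [monoM, Matrix.one_apply, eq_comm]
    · have : ∑ x ∈ pairsF n, pairW (1 : Equiv.Perm (Fin n)) (fun _ => 0) x = 0 := by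
        apply Finset.sum_eq_zero
        intro x hx
        rw [mem_pairsF] at hx
        simp [pairW, hx.le]
      simp [lenF, this]
  | append_singleton l y ih =>
    obtain ⟨σ, a, ha, hp, hle⟩ := ih (fun x hx => hl x (by simp [hx]))
    have hy := hl y (by simp)
    simp only [List.prod_append, List.prod_singleton, List.length_append, List.length_singleton]
    rw [hp]
    rcases hy with hy | ⟨j, hj2, hjn, hy⟩
    · rw [Set.mem_singleton_iff] at hy
      subst hy
      let i0 := σ.symm ⟨0, by omega⟩
      have h0 : (σ i0 : ℕ) = 0 := by simp [i0]
      have hm : (a i0 + 1) % d ≤ a i0 + 1 := Nat.mod_le _ _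
      have hne : ∀ i, i ≠ i0 → Function.update a i0 ((a i0 + 1) % d) i = a i := by
        intro i hi; simp [hi]
      refine ⟨σ, Function.update a i0 ((a i0 + 1) % d), ?_, ?_, ?_⟩
      · intro i
        by_cases hi : i = i0
        · subst hi; simpa using Nat.mod_lt _ (by omega)
        · simpa [hi] using ha i
      · apply monoM_mul_z hd n σ a _ i0 h0 hne
        rw [Function.update_self]
        exact (pow_eq_pow_mod _ (zeta_prim hd).pow_eq_one).symm
      · have := lenF_z σ a _ i0 h0 hne
        rw [Function.update_self] at this
        omega
    · obtain ⟨p, rfl⟩ : ∃ p, j = p + 2 := ⟨j - 2, by omega⟩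
      subst hy
      refine ⟨_, a, ha, monoM_mul_s d n σ a p (by omega), ?_⟩
      obtain ⟨x, hx, hs⟩ := exists_pair σ ⟨p, by omega⟩ ⟨p + 1, by omega⟩ rfl
      have h1 := lenF_s σ a _ _ rfl x hx hs
      have h2 := pairW_swap σ a _ _ rfl x hs
      split_ifs at h2 <;> omega

theorem perm_eq_one {n : ℕ} (σ : Equiv.Perm (Fin n)) (h : StrictMono σ) : σ = 1 := by
  have : (σ : Fin n → Fin n) = id := by
    apply (StrictMono.range_inj h strictMono_id).1
    rw [σ.surjective.range_eq, Set.range_id]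
  exact Equiv.ext fun x => congrFun this x

theorem descent {n : ℕ} (hn : 2 ≤ n) (σ : Equiv.Perm (Fin n)) (a : Fin n → ℕ)
    (hz : ∀ i, (σ i : ℕ) = 0 → a i = 0)
    (hs : ∀ (p : ℕ) (hp : p + 1 < n),
      lenF σ a ≤ lenF (Equiv.swap ⟨p, by omega⟩ ⟨p + 1, hp⟩ * σ) a) :
    σ = 1 ∧ a = fun _ => 0 := by
  have step : ∀ (p : ℕ) (hp : p + 1 < n), a (σ.symm ⟨p, by omega⟩) = 0 →
      a (σ.symm ⟨p + 1, hp⟩) = 0 ∧ σ.symm ⟨p, by omega⟩ < σ.symm ⟨p + 1, hp⟩ := by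
    intro p hp h0
    obtain ⟨⟨u, v⟩, hx, hpq⟩ := exists_pair σ ⟨p, by omega⟩ ⟨p + 1, by omega⟩ rfl
    have h1 := lenF_s σ a _ _ rfl _ hx hpq
    have h2 := pairW_swap σ a _ _ rfl _ hpq
    have h3 := hs p hp
    simp only at hpq h2 hx
    have hpne : (⟨p, by omega⟩ : Fin n) ≠ ⟨p + 1, hp⟩ := by simp [Fin.ext_iff]
    rcases hpq with ⟨e1, e2⟩ | ⟨e1, e2⟩
    · have f1 := (Equiv.symm_apply_eq σ).2 e1.symm
      have f2 := (Equiv.symm_apply_eq σ).2 e2.symm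
      rw [f1] at h0
      rw [f1, f2]
      refine ⟨?_, hx⟩
      by_contra hv
      rcases h2 with ⟨_, h4, h5⟩ | ⟨h, _⟩
      · rw [if_neg hv] at h4
        omega
      · exact hpne (e1.symm.trans h)
    · have f2 := (Equiv.symm_apply_eq σ).2 e2.symm
      rw [f2] at h0
      rcases h2 with ⟨h, _⟩ | ⟨_, h4, h5⟩
      · exact absurd (h.symm.trans e1) hpne
      · rw [if_pos h0] at h5
        omega
  have all0 : ∀ (k : ℕ) (hk : k < n), a (σ.symm ⟨k, hk⟩) = 0 := by
    intro k
    induction k with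
    | zero => intro hk; exact hz _ (by simp)
    | succ k ih => intro hk; exact (step k hk (ih (by omega))).1
  constructor
  · obtain ⟨m, rfl⟩ : ∃ m, n = m + 1 := ⟨n - 1, by omega⟩
    have : σ⁻¹ = 1 := by
      apply perm_eq_one
      rw [Fin.strictMono_iff_lt_succ]
      intro i
      exact (step i (by omega) (all0 _ _)).2
    simpa using this
  · funext i
    simpa using all0 (σ i) (σ i).2

theorem word_upper {d n : ℕ} (hd : 2 ≤ d) (hn : 2 ≤ n) (k : ℕ) :
    ∀ (σ : Equiv.Perm (Fin n)) (a : Fin n → ℕ), lenF σ a ≤ k →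
    ∃ l : List (Matrix (Fin n) (Fin n) ℂ), (∀ x ∈ l, x ∈ genX1 d n) ∧ l.length ≤ k ∧
      l.prod = monoM d n σ a := by
  have base : ∀ (k : ℕ) (σ : Equiv.Perm (Fin n)) (a : Fin n → ℕ), (σ = 1 ∧ a = fun _ => 0) →
    ∃ l : List (Matrix (Fin n) (Fin n) ℂ), (∀ x ∈ l, x ∈ genX1 d n) ∧ l.length ≤ k ∧
      l.prod = monoM d n σ a := by
    rintro k σ a ⟨rfl, rfl⟩
    refine ⟨[], by simp, by simp, ?_⟩
    ext i j
    simp [monoM, Matrix.one_apply, eq_comm]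
  induction k with
  | zero =>
    intro σ a hk
    apply base
    apply descent hn
    · intro i _
      have h1 : ∑ i, a i = 0 := by unfold lenF at hk; omega
      exact (Finset.sum_eq_zero_iff.1 h1) i (Finset.mem_univ _)
    · intro p hp; omega
  | succ k ih =>
    intro σ a hk
    by_cases hz : ∀ i, (σ i : ℕ) = 0 → a i = 0
    · by_cases hs : ∀ (p : ℕ) (hp : p + 1 < n),
        lenF σ a ≤ lenF (Equiv.swap ⟨p, by omega⟩ ⟨p + 1, hp⟩ * σ) a
      · exact base _ _ _ (descent hn σ a hz hs)
      · push Not at hs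
        obtain ⟨p, hp, hlt⟩ := hs
        obtain ⟨l, hl, hlen, hprod⟩ := ih _ a (by omega : lenF (Equiv.swap ⟨p, by omega⟩ ⟨p + 1, hp⟩ * σ) a ≤ k)
        refine ⟨l ++ [sMat n (p + 2)], ?_, by simpa using hlen, ?_⟩
        · intro x hx
          rcases List.mem_append.1 hx with h | h
          · exact hl x h
          · rw [List.mem_singleton] at h
            exact Or.inr ⟨p + 2, by omega, by omega, h⟩
        · rw [List.prod_append, List.prod_singleton, hprod, monoM_mul_s d n _ a p hp, ← mul_assoc,
            Equiv.swap_mul_self, one_mul]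
    · push Not at hz
      obtain ⟨i0, h0, hne⟩ := hz
      have hoff : ∀ i, i ≠ i0 → Function.update a i0 (a i0 - 1) i = a i := by
        intro i hi; simp [hi]
      have h1 := lenF_z σ a _ i0 h0 hoff
      rw [Function.update_self] at h1
      obtain ⟨l, hl, hlen, hprod⟩ := ih σ (Function.update a i0 (a i0 - 1)) (by omega)
      refine ⟨l ++ [zMat d n], ?_, by simpa using hlen, ?_⟩
      · intro x hx
        rcases List.mem_append.1 hx with h | h
        · exact hl x h
        · rw [List.mem_singleton] at h
          exact Or.inl h
      · rw [List.prod_append, List.prod_singleton, hprod]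
        apply monoM_mul_z hd n σ _ a i0 h0 (fun i hi => (hoff i hi).symm)
        rw [Function.update_self]
        congr 1; omega

theorem monoM_inj {d n : ℕ} (hd : 2 ≤ d) (σ τ : Equiv.Perm (Fin n)) (a b : Fin n → ℕ)
    (ha : ∀ i, a i < d) (hb : ∀ i, b i < d) (h : monoM d n σ a = monoM d n τ b) :
    σ = τ ∧ a = b := by
  have h0 : ∀ k, zetaC d ^ k ≠ 0 := fun k => pow_ne_zero _ ((zeta_prim hd).ne_zero (by omega))
  have key : ∀ i, σ i = τ i ∧ a i = b i := by
    intro i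
    have := congrFun (congrFun h i) (σ i)
    simp only [monoM, Matrix.of_apply, if_true] at this
    split_ifs at this with h1
    · exact ⟨h1, (zeta_prim hd).pow_inj (ha i) (hb i) this⟩
    · exact absurd this (h0 _)
  exact ⟨Equiv.ext fun i => (key i).1, funext fun i => (key i).2⟩

theorem len_eq {d n : ℕ} (hd : 2 ≤ d) (hn : 2 ≤ n) (σ : Equiv.Perm (Fin n)) (a : Fin n → ℕ)
    (ha : ∀ i, a i < d) : len (genX1 d n) (monoM d n σ a) = lenF σ a := by
  have lower : ∀ l : List (Matrix (Fin n) (Fin n) ℂ), (∀ x ∈ l, x ∈ genX1 d n) →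
      l.prod = monoM d n σ a → lenF σ a ≤ l.length := by
    intro l hl hp
    obtain ⟨τ, b, hb, hp', hle⟩ := word_lower hd hn l hl
    obtain ⟨rfl, rfl⟩ := monoM_inj hd _ _ _ _ ha hb (hp.symm.trans hp')
    exact hle
  obtain ⟨l, hl, hlen, hprod⟩ := word_upper hd hn (lenF σ a) σ a le_rfl
  have hmem : l.length ∈ {k | ∃ l : List (Matrix (Fin n) (Fin n) ℂ),
    (∀ x ∈ l, x ∈ genX1 d n) ∧ l.length = k ∧ l.prod = monoM d n σ a} := ⟨l, hl, rfl, hprod⟩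
  apply le_antisymm
  · exact (Nat.sInf_le hmem).trans hlen
  · obtain ⟨l', h1, h2, h3⟩ := Nat.sInf_mem ⟨_, hmem⟩
    unfold len
    rw [← h2]
    exact lower l' h1 h3

theorem card_pairsF (n : ℕ) : (pairsF n).card * 2 = n * (n - 1) := by
  have h1 : (pairsF n).card = ((Finset.univ : Finset (Fin n × Fin n)).filter fun x => x.2 < x.1).card := by
    apply Finset.card_bij (fun x _ => (x.2, x.1))
    · simp [mem_pairsF]
    · rintro ⟨a, b⟩ _ ⟨c, d⟩ _ h
      simp at h ⊢; tauto
    · rintro ⟨a, b⟩ h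
      exact ⟨(b, a), by simpa [mem_pairsF] using h, rfl⟩
  have h2 : (Finset.univ : Finset (Fin n)).offDiag.card = n * n - n := by
    rw [Finset.offDiag_card]; simp
  have h3 : (Finset.univ : Finset (Fin n)).offDiag =
      pairsF n ∪ ((Finset.univ : Finset (Fin n × Fin n)).filter fun x => x.2 < x.1) := by
    ext x
    simp [mem_pairsF, lt_or_lt_iff_ne]
  have h4 : Disjoint (pairsF n) ((Finset.univ : Finset (Fin n × Fin n)).filter fun x => x.2 < x.1) := by
    rw [Finset.disjoint_left]
    intro x hx hy
    rw [mem_pairsF] at hx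
    simp at hy
    exact absurd hx (not_lt.2 hy.le)
  rw [h3, Finset.card_union_of_disjoint h4, ← h1] at h2
  rw [Nat.mul_sub_one]
  omega

theorem total_eq {d n : ℕ} (hd : 2 ≤ d) (hn : 2 ≤ n) :
    ∑ _i : Fin n, (d - 1) + ∑ _x ∈ pairsF n, 2 = n * (n + d - 2) := by
  have : ∑ _x ∈ pairsF n, 2 = n * (n - 1) := by
    rw [Finset.sum_const, smul_eq_mul, card_pairsF]
  rw [this]
  simp only [Finset.sum_const, Finset.card_univ, Fintype.card_fin, smul_eq_mul]
  rw [← mul_add]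
  congr 1; omega

theorem lenF_max {d n : ℕ} (hd : 2 ≤ d) (hn : 2 ≤ n) :
    lenF (1 : Equiv.Perm (Fin n)) (fun _ => d - 1) = n * (n + d - 2) := by
  rw [← total_eq hd hn]
  unfold lenF
  congr 1
  apply Finset.sum_congr rfl
  intro x hx
  rw [mem_pairsF] at hx
  have : d - 1 ≠ 0 := by omega
  simp [pairW, hx.le, this]

theorem lenF_lt {d n : ℕ} (hd : 2 ≤ d) (hn : 2 ≤ n) (σ : Equiv.Perm (Fin n)) (a : Fin n → ℕ)
    (ha : ∀ i, a i < d) (hne : ¬ (σ = 1 ∧ a = fun _ => d - 1)) :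
    lenF σ a < n * (n + d - 2) := by
  have hA : ∀ i ∈ (Finset.univ : Finset (Fin n)), a i ≤ d - 1 := fun i _ => by have := ha i; omega
  have hB : ∀ x ∈ pairsF n, pairW σ a x ≤ 2 := fun x _ => pairW_le σ a x
  have s1 := Finset.sum_le_sum hA
  have s2 := Finset.sum_le_sum hB
  rw [← total_eq hd hn]
  unfold lenF
  by_contra hcon
  apply hne
  have e1 := (Finset.sum_eq_sum_iff_of_le hA).1 (by omega)
  have e2 := (Finset.sum_eq_sum_iff_of_le hB).1 (by omega)
  refine ⟨perm_eq_one σ ?_, funext fun i => e1 i (Finset.mem_univ i)⟩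
  intro i j hij
  have := e2 (i, j) ((mem_pairsF _).2 hij)
  unfold pairW at this
  simp only at this
  have h : ¬ σ j < σ i := by
    intro h
    rw [if_pos h] at this
    omega
  exact lt_of_le_of_ne (not_lt.1 h) (fun h => hij.ne (σ.injective h))

theorem scalar_eq (d n : ℕ) : (zetaC d ^ (d - 1)) • (1 : Matrix (Fin n) (Fin n) ℂ) =
    monoM d n 1 (fun _ => d - 1) := by
  ext i j
  simp [monoM, Matrix.one_apply, eq_comm]

/-- The scalar matrix `ζ_d^{d-1}·Iₙ` is the unique element of `G(d,1,n)` of maximal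
length over `X`, and its length is `n(n + d - 2)`. -/
theorem unique_max_length_in_Gd1n (d n : ℕ) (hd : 2 ≤ d) (hn : 2 ≤ n) :
    (zetaC d ^ (d - 1)) • (1 : Matrix (Fin n) (Fin n) ℂ) ∈ Gd1n d n ∧
    len (genX1 d n) ((zetaC d ^ (d - 1)) • (1 : Matrix (Fin n) (Fin n) ℂ)) =
      n * (n + d - 2) ∧
    ∀ w ∈ Gd1n d n, w ≠ (zetaC d ^ (d - 1)) • (1 : Matrix (Fin n) (Fin n) ℂ) →
      len (genX1 d n) w < n * (n + d - 2) := by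
  rw [scalar_eq]
  have hsc : ∀ i : Fin n, (fun _ : Fin n => d - 1) i < d := fun _ => by simp only; omega
  refine ⟨⟨1, ?_, ?_⟩, ?_, ?_⟩
  · intro i j
    have : zetaC d ^ (d - 1) ≠ 0 := pow_ne_zero _ ((zeta_prim hd).ne_zero (by omega))
    by_cases hj : j = i <;> simp [monoM, hj, this]
  · intro i
    simp only [monoM, Matrix.of_apply, if_true]
    rw [← pow_mul, mul_comm, pow_mul, (zeta_prim hd).pow_eq_one, one_pow]
  · rw [len_eq hd hn _ _ hsc, lenF_max hd hn]
  · rintro w ⟨σ, h1, h2⟩ hne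
    haveI : NeZero d := ⟨by omega⟩
    have h3 : ∀ i, ∃ k, k < d ∧ zetaC d ^ k = w i (σ i) := fun i =>
      (zeta_prim hd).eq_pow_of_pow_eq_one (h2 i)
    choose a ha hw using h3
    have hwm : w = monoM d n σ a := by
      ext i j
      simp only [monoM, Matrix.of_apply]
      split_ifs with h
      · rw [h, hw]
      · by_contra hc
        exact h ((h1 i j).1 hc)
    rw [hwm, len_eq hd hn σ a ha]
    apply lenF_lt hd hn σ a ha
    rintro ⟨rfl, rfl⟩
    exact hne hwm
end
end
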